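/- arXiv:2411.13656 — 2 statements merged into one kernel-verified Lean document; each statement's English description precedes it below -/
import Mathlib

section
/- For every two integers k, M ≥ 1 there exists an integer N = N(k, M) ≥ 1 such that every connected graph G with at least N vertices and no (k+1)-tangle admits an RC-decomposition (R, W, Z, C) of length at least M and adhesion ℓ with |Z| + ℓ ≥ 1. -/
open Finset

variable {V : Type} [Fintype V] [DecidableEq V]

/-- `{A, B}` is a separation of the graph `G`: the two sides together cover the vertex set and
no edge of `G` joins `A \ B` to `B \ A`. -/
def IsSep (G : SimpleGraph V) (A B : Finset V) : Prop :=
  A ∪ B = Finset.univ ∧ ∀ a ∈ A \ B, ∀ b ∈ B \ A, ¬ G.Adj a b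

/-- `G[A₁] ∪ G[A₂] ∪ G[A₃] = G` for the induced subgraphs on `A₁`, `A₂`, `A₃`. -/
def CoversG (G : SimpleGraph V) (A₁ A₂ A₃ : Finset V) : Prop :=
  (∀ v : V, v ∈ A₁ ∨ v ∈ A₂ ∨ v ∈ A₃) ∧
    ∀ u v : V, G.Adj u v →
      (u ∈ A₁ ∧ v ∈ A₁) ∨ (u ∈ A₂ ∧ v ∈ A₂) ∨ (u ∈ A₃ ∧ v ∈ A₃)

/-- `τ` is a `k`-tangle in `G`: a set of oriented separations of order `< k` containing exactly
one orientation of every separation of order `< k`, and no three of its elements have small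
sides whose induced subgraphs together cover `G`. -/
def IsTangle (G : SimpleGraph V) (k : ℕ) (τ : Set (Finset V × Finset V)) : Prop :=
  (∀ p ∈ τ, IsSep G p.1 p.2 ∧ (p.1 ∩ p.2).card < k) ∧
    (∀ A B : Finset V, IsSep G A B → (A ∩ B).card < k → ((A, B) ∈ τ ↔ (B, A) ∉ τ)) ∧
    ∀ p₁ ∈ τ, ∀ p₂ ∈ τ, ∀ p₃ ∈ τ, ¬ CoversG G p₁.1 p₂.1 p₃.1

/-- There is a `U`–`U'` linkage of cardinality `ℓ` in the induced subgraph of `G` on `s`: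
`ℓ` pairwise disjoint paths, each with all its vertices in `s`, meeting `U` exactly in one
endvertex and `U'` exactly in the other endvertex. -/
def ExistsLinkage (G : SimpleGraph V) (s U U' : Finset V) (ℓ : ℕ) : Prop :=
  ∃ (a b : Fin ℓ → V) (P : ∀ i, G.Walk (a i) (b i)),
    (∀ i, (P i).IsPath) ∧
    (∀ i, ∀ x ∈ (P i).support, x ∈ s) ∧
    (∀ i, a i ∈ U ∧ b i ∈ U') ∧
    (∀ i, ∀ x ∈ (P i).support, (x ∈ U ↔ x = a i) ∧ (x ∈ U' ↔ x = b i)) ∧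
    (∀ i j, i ≠ j → ∀ x ∈ (P i).support, x ∉ (P j).support)

/-- `W` is a linear decomposition of length `M` and adhesion `ℓ` of the induced subgraph of
`G` on the vertex set `r`. -/
structure IsLinDecomp (G : SimpleGraph V) (r : Finset V) (M ℓ : ℕ)
    (W : ℕ → Finset V) : Prop where
  subset_r : ∀ i ≤ M, W i ⊆ r
  coverV : ∀ x ∈ r, ∃ i ≤ M, x ∈ W i
  coverE : ∀ x ∈ r, ∀ y ∈ r, G.Adj x y → ∃ i ≤ M, x ∈ W i ∧ y ∈ W i
  nested : ∀ i j h : ℕ, i ≤ j → j ≤ h → h ≤ M → W i ∩ W h ⊆ W j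
  adhesion : ∀ i, 1 ≤ i → i ≤ M → (W (i - 1) ∩ W i).card = ℓ
  ne_left : ∀ i, 1 ≤ i → i ≤ M → W (i - 1) ∩ W i ≠ W (i - 1)
  ne_right : ∀ i, 1 ≤ i → i ≤ M → W (i - 1) ∩ W i ≠ W i

/-- `W` is a rainbow-decomposition of length `M` and adhesion `ℓ` of the induced subgraph of
`G` on the vertex set `r`. -/
structure IsRainbowDecomp (G : SimpleGraph V) (r : Finset V) (M ℓ : ℕ)
    (W : ℕ → Finset V) extends IsLinDecomp G r M ℓ W : Prop where
  r1 : ∀ i, 1 ≤ i → i + 1 ≤ M →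
    ExistsLinkage G (W i) (W (i - 1) ∩ W i) (W i ∩ W (i + 1)) ℓ
  r2 : ∀ i ≤ M, (G.induce (W i : Set V)).Connected
  r3 : ∀ i, 1 ≤ i → i + 1 ≤ M → Disjoint (W (i - 1) ∩ W i) (W i ∩ W (i + 1))

/-- `(R, W, Z, C)` (given by the vertex sets `r`, `z`, `c` of the rainbow `R`, the sun `Z` and
the cloud `C`, together with the bags `W`) is an RC-decomposition of `G` of length `M` and
adhesion `ℓ`. -/
structure IsRCDecomp (G : SimpleGraph V) (r z c : Finset V) (M ℓ : ℕ)
    (W : ℕ → Finset V) : Prop where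
  rainbow : IsRainbowDecomp G r M ℓ W
  sun_sub_cloud : z ⊆ c
  sun_disj_rainbow : Disjoint z r
  cover_v : ∀ x : V, x ∈ r ∪ z ∪ c
  cover_e : ∀ x y : V, G.Adj x y → (x ∈ r ∪ z ∧ y ∈ r ∪ z) ∨ (x ∈ c ∧ y ∈ c)
  rc1 : r ∩ c = (c ∩ W 0) ∪ (c ∩ W M)
  rc2_card : (c ∩ W 0).card = ℓ ∧ (c ∩ W M).card = ℓ
  rc2_disj : Disjoint (c ∩ W 0) (W 0 ∩ W 1) ∧ Disjoint (W (M - 1) ∩ W M) (c ∩ W M)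
  rc3 : ExistsLinkage G (W 0) (c ∩ W 0) (W 0 ∩ W 1) ℓ ∧
    ExistsLinkage G (W M) (W (M - 1) ∩ W M) (c ∩ W M) ℓ
  rc4 : ∀ i ≤ M, ∀ x ∈ z, ∃ y ∈ W i, G.Adj x y

/-- Every separation `(A, B)` of `G[s]` with `X ⊆ A` and `Y ⊆ B` has order at least `q`. -/
def NoSmallCut (G : SimpleGraph V) (s X Y : Finset V) (q : ℕ) : Prop :=
  ∀ A B : Finset V, A ∪ B = s → X ⊆ A → Y ⊆ B →
    (∀ a ∈ A \ B, ∀ b ∈ B \ A, ¬ G.Adj a b) → q ≤ (A ∩ B).card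

/-- There are `q` pairwise disjoint connected subsets of `s`, each meeting both `X` and `Y`. -/
def HasConnectors (G : SimpleGraph V) (s X Y : Finset V) (q : ℕ) : Prop :=
  ∃ (a b : Fin q → V) (C : Fin q → Finset V),
    (∀ i, a i ∈ X ∧ b i ∈ Y ∧ a i ∈ C i ∧ b i ∈ C i ∧ C i ⊆ s ∧
      (G.induce (C i : Set V)).Connected) ∧
    ∀ i j, i ≠ j → Disjoint (C i) (C j)

lemma HasConnectors.mono {G H : SimpleGraph V} (h : G ≤ H) {s X Y : Finset V} {q : ℕ}
    (hc : HasConnectors G s X Y q) : HasConnectors H s X Y q := by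
  obtain ⟨a, b, C, h1, h2⟩ := hc
  refine ⟨a, b, C, fun i => ?_, h2⟩
  obtain ⟨x1, x2, x3, x4, x5, x6⟩ := h1 i
  exact ⟨x1, x2, x3, x4, x5, x6.mono (fun _ _ hh => h hh)⟩

/-- Pairwise disjoint sets represented by elements of a set of the same size hit each element
of that set. -/
lemma exists_index_of_card_eq {q : ℕ} {P : Finset V} (hP : P.card = q) {b : Fin q → V}
    {C : Fin q → Finset V} (hb : ∀ i, b i ∈ P) (hC : ∀ i, b i ∈ C i)
    (hd : ∀ i j, i ≠ j → Disjoint (C i) (C j)) :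
    Function.Injective b ∧ ∀ p ∈ P, ∃ i, b i = p := by
  have hinj : Function.Injective b := by
    intro i j hij
    by_contra hne
    exact Finset.disjoint_left.1 (hd i j hne) (hC i) (hij ▸ hC j)
  refine ⟨hinj, fun p hp => ?_⟩
  have h1 : Finset.univ.image b ⊆ P := by
    intro x hx
    obtain ⟨i, -, rfl⟩ := Finset.mem_image.1 hx
    exact hb i
  have h2 : Finset.univ.image b = P := by
    apply Finset.eq_of_subset_of_card_le h1
    rw [Finset.card_image_of_injective _ hinj, hP]
    simp
  rw [← h2] at hp
  obtain ⟨i, -, hi⟩ := Finset.mem_image.1 hp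
  exact ⟨i, hi⟩

lemma HasConnectors.glue {G : SimpleGraph V} {A B X Y : Finset V} {q : ℕ} {a b : V}
    (hab : G.Adj a b) (haB : a ∉ B) (hbA : b ∉ A)
    (hP : (insert a (A ∩ B)).card = q) (hQ : (insert b (A ∩ B)).card = q)
    (h1 : HasConnectors G A X (insert a (A ∩ B)) q)
    (h2 : HasConnectors G B (insert b (A ∩ B)) Y q) : HasConnectors G (A ∪ B) X Y q := by
  obtain ⟨a1, b1, C1, h1, d1⟩ := h1
  obtain ⟨a2, b2, C2, h2, d2⟩ := h2
  obtain ⟨inj1, sur1⟩ := exists_index_of_card_eq hP (fun i => (h1 i).2.1)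
    (fun i => (h1 i).2.2.2.1) d1
  obtain ⟨inj2, sur2⟩ := exists_index_of_card_eq hQ (fun i => (h2 i).1)
    (fun i => (h2 i).2.2.1) d2
  have key : ∀ i, ∃ j, a2 j = if b1 i = a then b else b1 i := by
    intro i
    apply sur2
    have := (h1 i).2.1
    grind
  choose π hπ using key
  have πinj : ∀ i j, π i = π j → i = j := by
    intro i j hij
    have e1 := hπ i
    have e2 := hπ j
    rw [hij] at e1
    have := (h1 i).2.1
    have := (h1 j).2.1
    apply inj1
    grind
  have cross : ∀ i j, i ≠ j → Disjoint (C1 i) (C2 (π j)) := by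
    intro i j hij
    rw [Finset.disjoint_left]
    intro v hv1 hv2
    have hvA := (h1 i).2.2.2.2.1 hv1
    have hvB := (h2 (π j)).2.2.2.2.1 hv2
    obtain ⟨k, hk⟩ := sur1 v (by grind)
    have hki : k = i := by
      by_contra hne
      exact Finset.disjoint_left.1 (d1 k i hne) (hk ▸ (h1 k).2.2.2.1) hv1
    subst hki
    have e := hπ k
    rw [if_neg (by rintro rfl; exact haB (hk ▸ hvB)), hk] at e
    have : π k ≠ π j := fun h => hij (πinj _ _ h)
    exact Finset.disjoint_left.1 (d2 _ _ this) (e ▸ (h2 (π k)).2.2.1) hv2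
  refine ⟨a1, fun i => b2 (π i), fun i => C1 i ∪ C2 (π i), fun i => ?_, fun i j hij => ?_⟩
  · refine ⟨(h1 i).1, (h2 (π i)).2.1, Finset.mem_union_left _ (h1 i).2.2.1,
      Finset.mem_union_right _ (h2 (π i)).2.2.2.1,
      Finset.union_subset_union (h1 i).2.2.2.2.1 (h2 (π i)).2.2.2.2.1, ?_⟩
    rw [Finset.coe_union]
    have e := hπ i
    by_cases hc : b1 i = a
    · rw [if_pos hc] at e
      exact SimpleGraph.connected_induce_union (v := a) (w := b) (h1 i).2.2.2.2.2.preconnected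
        (h2 (π i)).2.2.2.2.2.preconnected (hc ▸ (h1 i).2.2.2.1) (e ▸ (h2 (π i)).2.2.1) hab
    · rw [if_neg hc] at e
      exact SimpleGraph.induce_union_connected (h1 i).2.2.2.2.2.preconnected
        (h2 (π i)).2.2.2.2.2.preconnected ⟨b1 i, (h1 i).2.2.2.1, e ▸ (h2 (π i)).2.2.1⟩
  · rw [Finset.disjoint_union_left, Finset.disjoint_union_right, Finset.disjoint_union_right]
    exact ⟨⟨d1 i j hij, cross i j hij⟩, (cross j i hij.symm).symm,
      d2 _ _ fun h => hij (πinj _ _ h)⟩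

/-- Menger's theorem. -/
theorem NoSmallCut.hasConnectors {G : SimpleGraph V} {s X Y : Finset V} {q : ℕ}
    (hX : X ⊆ s) (hY : Y ⊆ s) (h : NoSmallCut G s X Y q) : HasConnectors G s X Y q := by
  classical
  induction G using WellFoundedLT.induction generalizing s X Y with
  | ind G ih =>
  by_cases hE : ∃ x y, G.Adj x y
  · obtain ⟨x, y, hxy⟩ := hE
    set G' := G.deleteEdges {s(x, y)} with hG'
    have hadj : ∀ u v, G'.Adj u v ↔ G.Adj u v ∧ s(u, v) ≠ s(x, y) := by
      intro u v; simp [hG', SimpleGraph.deleteEdges_adj]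
    have hle : G' ≤ G := fun u v huv => ((hadj u v).1 huv).1
    have hlt : G' < G := by
      refine lt_of_le_of_ne hle fun he => ?_
      have := (hadj x y).1 (he ▸ hxy)
      exact this.2 rfl
    clear_value G'
    by_cases hc : NoSmallCut G' s X Y q
    · exact (ih G' hlt hX hY hc).mono hle
    · unfold NoSmallCut at hc
      push Not at hc
      obtain ⟨A, B, hAB, hXA, hYB, hsep, hcard⟩ := hc
      have : ∃ a ∈ A \ B, ∃ b ∈ B \ A, G.Adj a b := by
        by_contra hno
        push Not at hno
        exact absurd (h A B hAB hXA hYB hno) (by omega)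
      obtain ⟨a, ha, b, hb, hab⟩ := this
      have hs : s(a, b) = s(x, y) := by
        by_contra hne
        exact hsep a ha b hb ((hadj a b).2 ⟨hab, hne⟩)
      rw [← hs] at hadj
      simp only [Finset.mem_sdiff] at ha hb
      have huniq : ∀ u ∈ A, u ∉ B → ∀ v ∈ B, v ∉ A → G.Adj u v → u = a ∧ v = b := by
        intro u hu hu' v hv hv' huv
        have h1 := hsep u (by simp [hu, hu']) v (by simp [hv, hv'])
        rw [hadj] at h1
        have h2 : s(u, v) = s(a, b) := by
          by_contra hne; exact h1 ⟨huv, hne⟩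
        rw [Sym2.eq_iff] at h2
        rcases h2 with h2 | h2
        · exact h2
        · exact absurd (h2.1 ▸ hu) hb.2
      have hP' : (insert a (A ∩ B)).card = (A ∩ B).card + 1 :=
        Finset.card_insert_of_notMem (by simp [ha.2])
      have hQ' : (insert b (A ∩ B)).card = (A ∩ B).card + 1 :=
        Finset.card_insert_of_notMem (by simp [hb.2])
      have hq : q ≤ (A ∩ B).card + 1 := by
        rw [← hP']
        refine (h A (insert a B) ?_ hXA (hYB.trans (Finset.subset_insert _ _)) ?_).trans
          (Finset.card_le_card ?_)
        · grind
        · intro u hu v hv huv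
          grind
        · grind
      rw [← hAB]
      refine HasConnectors.glue hab ha.2 hb.2 (by omega) (by omega) ?_ ?_
      · refine (ih G' hlt hXA (by grind) ?_).mono hle
        intro A1 A2 h12 h1 h2 h3
        have hA1 : A1 ⊆ A := h12 ▸ Finset.subset_union_left
        refine (h A1 (A2 ∪ B) ?_ h1 (hYB.trans Finset.subset_union_right) ?_).trans
          (Finset.card_le_card ?_)
        · rw [← Finset.union_assoc, h12, hAB]
        · intro u hu v hv huv
          by_cases hvA : v ∈ A
          · have hv2 : v ∈ A2 \ A1 := by
              have : v ∈ A1 ∪ A2 := h12 ▸ hvA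
              grind
            refine h3 u (by grind) v hv2 ((hadj u v).2 ⟨huv, ?_⟩)
            rw [Ne, Sym2.eq_iff]
            grind
          · have := huniq u (by grind) (by grind) v (by grind) hvA huv
            grind
        · intro v hv
          grind
      · refine (ih G' hlt (by grind) hYB ?_).mono hle
        intro B1 B2 h12 h1 h2 h3
        have hB2 : B2 ⊆ B := h12 ▸ Finset.subset_union_right
        refine (h (A ∪ B1) B2 ?_ (hXA.trans Finset.subset_union_left) h2 ?_).trans
          (Finset.card_le_card ?_)
        · rw [Finset.union_assoc, h12, hAB]
        · intro u hu v hv huv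
          by_cases huB : u ∈ B
          · have hu2 : u ∈ B1 \ B2 := by
              have : u ∈ B1 ∪ B2 := h12 ▸ huB
              grind
            refine h3 u hu2 v (by grind) ((hadj u v).2 ⟨huv, ?_⟩)
            rw [Ne, Sym2.eq_iff]
            grind
          · have := huniq u (by grind) (by grind) v (by grind) (by grind) huv
            grind
        · intro v hv
          grind
  · push Not at hE
    have hcard : q ≤ (X ∩ Y).card := by
      refine (h X (s \ X ∪ Y) ?_ (Finset.Subset.refl _) Finset.subset_union_right
        (fun a _ b _ => hE a b)).trans (Finset.card_le_card ?_)
      · grind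
      · grind
    obtain ⟨T, hT, hTc⟩ := Finset.exists_subset_card_eq hcard
    let e := (Finset.equivFinOfCardEq hTc).symm
    refine ⟨fun i => e i, fun i => e i, fun i => {(e i : V)}, fun i => ?_, fun i j hij => ?_⟩
    · have := hT (e i).2
      rw [Finset.mem_inter] at this
      refine ⟨this.1, this.2, by simp, by simp, by simpa using hX this.1, ?_⟩
      rw [Finset.coe_singleton]
      have : Nonempty ({(e i : V)} : Set V) := ⟨⟨_, rfl⟩⟩
      exact ⟨SimpleGraph.Preconnected.of_subsingleton⟩
    · simpa [Subtype.ext_iff] using fun h => hij (e.injective (Subtype.ext h))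

lemma NoSmallCut.existsLinkage {G : SimpleGraph V} {s X Y : Finset V} {q : ℕ}
    (hX : X ⊆ s) (hY : Y ⊆ s) (hXq : X.card = q) (hYq : Y.card = q)
    (h : NoSmallCut G s X Y q) : ExistsLinkage G s X Y q := by
  obtain ⟨a, b, C, h1, d⟩ := h.hasConnectors hX hY
  have hw : ∀ i, ∃ p : G.Walk (a i) (b i), p.IsPath ∧ ∀ x ∈ p.support, x ∈ C i := by
    intro i
    obtain ⟨-, -, ha, hb, -, hc⟩ := h1 i
    obtain ⟨p⟩ := hc.preconnected ⟨a i, ha⟩ ⟨b i, hb⟩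
    let p' : G.Walk (a i) (b i) := p.map (SimpleGraph.Embedding.induce (G := G) (C i : Set V)).toHom
    have hp' : ∀ x ∈ p'.support, x ∈ C i := by
      intro x hx
      replace hx : x ∈ (p.map (SimpleGraph.Embedding.induce (G := G) (C i : Set V)).toHom).support :=
        hx
      rw [SimpleGraph.Walk.support_map, List.mem_map] at hx
      obtain ⟨y, -, rfl⟩ := hx
      exact y.2
    exact ⟨p'.bypass, p'.bypass_isPath, fun x hx => hp' x (p'.support_bypass_subset_support hx)⟩
  choose P hP hPs using hw
  have hexact : ∀ (Z : Finset V) (f : Fin q → V), Z.card = q → (∀ i, f i ∈ Z) →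
      (∀ i, f i ∈ C i) → ∀ i, ∀ x ∈ C i, (x ∈ Z ↔ x = f i) := by
    intro Z f hZ hf hfC i x hx
    refine ⟨fun hxZ => ?_, fun h => h ▸ hf i⟩
    obtain ⟨k, hk⟩ := (exists_index_of_card_eq hZ hf hfC d).2 x hxZ
    by_cases hki : k = i
    · rw [← hk, hki]
    · exact absurd hx (Finset.disjoint_left.1 (d k i hki) (hk ▸ hfC k))
  refine ⟨a, b, P, hP, fun i x hx => (h1 i).2.2.2.2.1 (hPs i x hx),
    fun i => ⟨(h1 i).1, (h1 i).2.1⟩, fun i x hx => ⟨?_, ?_⟩, fun i j hij x hx hx' => ?_⟩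
  · exact hexact X a hXq (fun i => (h1 i).1) (fun i => (h1 i).2.2.1) i x (hPs i x hx)
  · exact hexact Y b hYq (fun i => (h1 i).2.1) (fun i => (h1 i).2.2.2.1) i x (hPs i x hx)
  · exact Finset.disjoint_left.1 (d i j hij) (hPs i x hx) (hPs j x hx')

lemma exists_balanced_sep {G : SimpleGraph V} {k : ℕ}
    (h : ¬ ∃ τ : Set (Finset V × Finset V), IsTangle G (k + 1) τ) (X : Finset V) :
    ∃ C D : Finset V, IsSep G C D ∧ (C ∩ D).card ≤ k ∧
      X.card ≤ 3 * (C ∩ X).card ∧ X.card ≤ 3 * (D ∩ X).card := by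
  by_contra hno
  push Not at hno
  apply h
  refine ⟨{p | IsSep G p.1 p.2 ∧ (p.1 ∩ p.2).card < k + 1 ∧ 3 * (p.1 ∩ X).card < X.card},
    fun p hp => ⟨hp.1, hp.2.1⟩, fun A B hAB hc => ?_, fun p₁ h₁ p₂ h₂ p₃ h₃ hcov => ?_⟩
  · have hBA : IsSep G B A :=
      ⟨by rw [Finset.union_comm]; exact hAB.1, fun a ha b hb hadj => hAB.2 b hb a ha hadj.symm⟩
    have hc' : (B ∩ A).card < k + 1 := by rwa [Finset.inter_comm]
    have h1 := hno A B hAB (by omega)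
    have h2 : X.card ≤ (A ∩ X).card + (B ∩ X).card := by
      refine (Finset.card_le_card ?_).trans (Finset.card_union_le _ _)
      rw [← Finset.union_inter_distrib_right, hAB.1, Finset.univ_inter]
    simp only [Set.mem_setOf_eq, hAB, hBA, hc, hc', true_and]
    omega
  · have h4 : X.card ≤ (p₁.1 ∩ X).card + (p₂.1 ∩ X).card + (p₃.1 ∩ X).card := by
      have : X ⊆ (p₁.1 ∩ X ∪ p₂.1 ∩ X) ∪ p₃.1 ∩ X := by
        intro x hx
        have := hcov.1 x
        grind
      refine (Finset.card_le_card this).trans ((Finset.card_union_le _ _).trans ?_)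
      gcongr
      exact Finset.card_union_le _ _
    have := h₁.2.2
    have := h₂.2.2
    have := h₃.2.2
    omega

/-- A nested sequence of separations of order less than `w` whose first `n` steps are strict. -/
structure IsSepChain (G : SimpleGraph V) (w n : ℕ) (A B : ℕ → Finset V) : Prop where
  sep : ∀ i, IsSep G (A i) (B i)
  mono : Monotone A
  anti : Antitone B
  card_lt : ∀ i, (A i ∩ B i).card < w
  strict : ∀ i < n, A i ≠ A (i + 1)

lemma IsSep.mem_or {G : SimpleGraph V} {A B : Finset V} (h : IsSep G A B) (v : V) :
    v ∈ A ∨ v ∈ B := by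
  have : v ∈ A ∪ B := h.1 ▸ Finset.mem_univ v
  simpa using this

lemma exists_smaller_sep {G : SimpleGraph V} {k m : ℕ}
    (h : ¬ ∃ τ : Set (Finset V × Finset V), IsTangle G (k + 1) τ) {A B : Finset V}
    (hAB : IsSep G A B) (hc : (A ∩ B).card < 3 * k + 2) (hA : 3 * k + 1 ≤ A.card)
    (hm : 2 * m ≤ A.card) :
    ∃ A' B' : Finset V, IsSep G A' B' ∧ (A' ∩ B').card < 3 * k + 2 ∧ A' ⊆ A ∧ B ⊆ B' ∧
      A' ≠ A ∧ m ≤ A'.card := by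
  obtain ⟨X, hX1, hX2, hXc⟩ := Finset.exists_subsuperset_card_eq
    (s := A ∩ B) (t := A) (n := 3 * k + 1) Finset.inter_subset_left (by omega) hA
  obtain ⟨C, D, hCD, hk, hC, hD⟩ := exists_balanced_sep h X
  have key : ∀ C D : Finset V, IsSep G C D → (C ∩ D).card ≤ k → X.card ≤ 3 * (D ∩ X).card →
      m ≤ (A ∩ C).card → ∃ A' B' : Finset V, IsSep G A' B' ∧ (A' ∩ B').card < 3 * k + 2 ∧
        A' ⊆ A ∧ B ⊆ B' ∧ A' ≠ A ∧ m ≤ A'.card := by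
    intro C D hCD hk hD hm
    refine ⟨A ∩ C, B ∪ D, ⟨?_, ?_⟩, ?_, Finset.inter_subset_left, Finset.subset_union_left,
      ?_, hm⟩
    · ext v
      have := hAB.mem_or v
      have := hCD.mem_or v
      grind
    · intro a ha b hb hadj
      have h1 := hAB.2 a (by grind)
      have h2 := hCD.2 a (by grind)
      have := hAB.mem_or b
      have := hCD.mem_or b
      by_cases hbA : b ∈ A
      · exact h2 b (by grind) hadj
      · exact h1 b (by grind) hadj
    · have h1 : (A ∩ C) ∩ (B ∪ D) ⊆ (X \ (D ∩ X)) ∪ (C ∩ D) := by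
        intro v hv
        have := @hX1 v
        grind
      have h2 := (Finset.card_le_card h1).trans (Finset.card_union_le _ _)
      have h3 := Finset.card_sdiff_add_card_eq_card (Finset.inter_subset_right : D ∩ X ⊆ X)
      omega
    · intro he
      have h1 : D ∩ X ⊆ C ∩ D := by
        intro v hv
        have : v ∈ A ∩ C := he.symm ▸ hX2 (Finset.mem_inter.1 hv).2
        grind
      have := Finset.card_le_card h1
      omega
  have hsum : A.card ≤ (A ∩ C).card + (A ∩ D).card := by
    refine (Finset.card_le_card ?_).trans (Finset.card_union_le _ _)
    rw [← Finset.inter_union_distrib_left, hCD.1, Finset.inter_univ]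
  by_cases hAC : m ≤ (A ∩ C).card
  · exact key C D hCD hk hD hAC
  · refine key D C ⟨by rw [Finset.union_comm]; exact hCD.1,
      fun a ha b hb hadj => hCD.2 b hb a ha hadj.symm⟩ (by rwa [Finset.inter_comm]) hC (by omega)

lemma exists_sepChain_below {G : SimpleGraph V} {k : ℕ}
    (h : ¬ ∃ τ : Set (Finset V × Finset V), IsTangle G (k + 1) τ) (n : ℕ) {A B : Finset V}
    (hAB : IsSep G A B) (hc : (A ∩ B).card < 3 * k + 2) (hA : 2 ^ n * (3 * k + 1) ≤ A.card) :
    ∃ A' B' : ℕ → Finset V, IsSepChain G (3 * k + 2) n A' B' ∧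
      ∀ i ≥ n, A' i = A ∧ B' i = B := by
  induction n generalizing A B with
  | zero =>
    exact ⟨fun _ => A, fun _ => B, ⟨fun _ => hAB, monotone_const, antitone_const, fun _ => hc,
      fun i hi => by omega⟩, fun _ _ => ⟨rfl, rfl⟩⟩
  | succ n ih =>
    have hpos : 1 ≤ 2 ^ n := Nat.one_le_two_pow
    obtain ⟨A₁, B₁, hs, hc₁, hA₁, hB₁, hne, hm⟩ := exists_smaller_sep (m := 2 ^ n * (3 * k + 1))
      h hAB hc (by rw [pow_succ] at hA; nlinarith) (by rw [pow_succ] at hA; linarith)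
    obtain ⟨A', B', hch, hend⟩ := ih hs hc₁ hm
    have hA' : ∀ i, A' i ⊆ A := fun i =>
      (hch.mono (le_max_left i n)).trans ((hend _ (le_max_right i n)).1 ▸ hA₁)
    have hB' : ∀ i, B ⊆ B' i := fun i =>
      Finset.Subset.trans ((hend _ (le_max_right i n)).2 ▸ hB₁) (hch.anti (le_max_left i n))
    refine ⟨fun i => if i ≤ n then A' i else A, fun i => if i ≤ n then B' i else B,
      ⟨fun i => ?_, fun i j hij => ?_, fun i j hij => ?_, fun i => ?_, fun i hi => ?_⟩,
      fun i hi => ?_⟩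
    · split_ifs
      exacts [hch.sep i, hAB]
    · split_ifs
      exacts [hch.mono hij, hA' i, by omega, le_rfl]
    · split_ifs
      exacts [hch.anti hij, by omega, hB' i, le_rfl]
    · split_ifs
      exacts [hch.card_lt i, hc]
    · rw [if_pos (by omega)]
      split_ifs
      · exact hch.strict i (by omega)
      · rw [(hend i (by omega)).1]
        exact hne
    · simp [show ¬ i ≤ n by omega]

lemma exists_sepChain {G : SimpleGraph V} {k : ℕ}
    (h : ¬ ∃ τ : Set (Finset V × Finset V), IsTangle G (k + 1) τ) (n : ℕ)
    (hV : 2 ^ n * (3 * k + 1) ≤ Fintype.card V) :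
    ∃ A B : ℕ → Finset V, IsSepChain G (3 * k + 2) n A B := by
  obtain ⟨A, B, hAB, -⟩ := exists_sepChain_below (A := Finset.univ) (B := ∅) h n
    ⟨by simp, by simp⟩ (by simp) (by simpa using hV)
  exact ⟨A, B, hAB⟩

/-- The first `n + 1` separations of a nested sequence all have order `p`, and no separation
between two of them has smaller order. -/
def IsLinkedChain (G : SimpleGraph V) (p n : ℕ) (A B : ℕ → Finset V) : Prop :=
  (∀ i ≤ n, (A i ∩ B i).card = p) ∧
    ∀ i j, i ≤ j → j ≤ n → ∀ X Y : Finset V, IsSep G X Y → A i ⊆ X → X ⊆ A j → B j ⊆ Y →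
      Y ⊆ B i → p ≤ (X ∩ Y).card

lemma exists_linkedChain (w n : ℕ) (hn : 1 ≤ n) :
    ∃ L : ℕ, ∀ (V : Type) [Fintype V] [DecidableEq V] (G : SimpleGraph V) (A B : ℕ → Finset V),
      IsSepChain G w L A B → ∃ (p : ℕ) (A' B' : ℕ → Finset V), p < w ∧
        IsSepChain G w n A' B' ∧ IsLinkedChain G p n A' B' := by
  induction w with
  | zero => exact ⟨0, fun V _ _ G A B h => absurd (h.card_lt 0) (by omega)⟩
  | succ w ih =>
    obtain ⟨L₁, ih⟩ := ih
    refine ⟨(2 * L₁ + 2) * n, fun V _ _ G A B h => ?_⟩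
    have hstrict : ∀ i j, i < j → i < (2 * L₁ + 2) * n → A i ≠ A j := by
      intro i j hij hi he
      refine h.strict i hi (le_antisymm (h.mono (Nat.le_succ i)) ?_)
      rw [he]
      exact h.mono hij
    by_cases hb : ∃ t ≤ 2 * L₁ + 1, ∀ X Y : Finset V, IsSep G X Y → A (t * n) ⊆ X →
        X ⊆ A (t * n + n) → B (t * n + n) ⊆ Y → Y ⊆ B (t * n) → w ≤ (X ∩ Y).card
    · obtain ⟨t, ht, hb⟩ := hb
      have hlt : ∀ i ≤ n, t * n + i ≤ (2 * L₁ + 2) * n := by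
        intro i hi
        calc t * n + i ≤ t * n + n := by omega
          _ = (t + 1) * n := by ring
          _ ≤ _ := Nat.mul_le_mul_right _ (by omega)
      refine ⟨w, fun i => A (t * n + i), fun i => B (t * n + i), by omega,
        ⟨fun i => h.sep _, fun i j hij => h.mono (by omega), fun i j hij => h.anti (by omega),
          fun i => h.card_lt _, fun i hi => h.strict (t * n + i)
            (by have := hlt (i + 1) (by omega); omega)⟩, fun i hi => ?_, ?_⟩
      · refine le_antisymm (Nat.lt_succ_iff.1 (h.card_lt _)) ?_
        exact hb _ _ (h.sep _) (h.mono (by omega)) (h.mono (by omega)) (h.anti (by omega))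
          (h.anti (by omega))
      · intro i j hij hj X Y hXY h1 h2 h3 h4
        exact hb X Y hXY ((h.mono (by omega)).trans h1) (h2.trans (h.mono (by omega)))
          (Finset.Subset.trans (h.anti (by omega)) h3)
          (Finset.Subset.trans h4 (h.anti (by omega)))
    · push Not at hb
      choose! X Y hXY h1 h2 h3 h4 hlt using hb
      have hmul : ∀ s t, s < t → s * n + n ≤ t * n := by
        intro s t hst
        calc s * n + n = (s + 1) * n := by ring
          _ ≤ t * n := Nat.mul_le_mul_right _ (by omega)
      let m : ℕ → ℕ := fun i => 2 * min i L₁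
      have hm : ∀ i, m i ≤ 2 * L₁ + 1 := fun i => by simp only [m]; omega
      have hmm : ∀ i j, i ≤ j → m i = m j ∨ m i < m j := fun i j hij => by
        simp only [m]; omega
      suffices hXYc : IsSepChain G w L₁ (fun i => X (m i)) (fun i => Y (m i)) by
        obtain ⟨p, A', B', hp, hch, hl⟩ := ih V G _ _ hXYc
        exact ⟨p, A', B', by omega, ⟨hch.sep, hch.mono, hch.anti,
          fun i => (hch.card_lt i).trans (Nat.lt_succ_self _), hch.strict⟩, hl⟩
      refine ⟨fun i => hXY _ (hm i), fun i j hij => ?_, fun i j hij => ?_, fun i => hlt _ (hm i),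
        fun i hi he => ?_⟩
      · rcases hmm i j hij with he | he
        · simp only [he]; exact le_rfl
        · exact (h2 _ (hm i)).trans ((h.mono (hmul _ _ he)).trans (h1 _ (hm j)))
      · rcases hmm i j hij with he | he
        · simp only [he]; exact le_rfl
        · exact (h4 _ (hm j)).trans (Finset.Subset.trans (h.anti (hmul _ _ he)) (h3 _ (hm i)))
      · have e1 : m i + 1 < m (i + 1) := by simp only [m]; omega
        have e2 := hmul _ _ (Nat.lt_succ_self (m i))
        have e3 := hmul _ _ e1
        have e4 : m (i + 1) * n ≤ (2 * L₁ + 2) * n :=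
          Nat.mul_le_mul_right _ ((hm _).trans (by omega))
        refine hstrict ((m i + 1) * n) (m (i + 1) * n) (by omega) (by omega)
          (le_antisymm (h.mono (by omega)) ?_)
        have e5 : A (m (i + 1) * n) ⊆ X (m (i + 1)) := h1 _ (hm _)
        have e6 : X (m i) ⊆ A (m i * n + n) := h2 _ (hm _)
        have e7 : X (m i) = X (m (i + 1)) := he
        rw [← e7] at e5
        exact (e5.trans e6).trans (h.mono (by omega))

lemma IsLinkedChain.noSmallCut {G : SimpleGraph V} {w p n m : ℕ} {A B : ℕ → Finset V}
    (hc : IsSepChain G w m A B) (h : IsLinkedChain G p n A B) {i j : ℕ} (hij : i ≤ j)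
    (hj : j ≤ n) : NoSmallCut G (B i ∩ A j) (A i ∩ B i) (A j ∩ B j) p := by
  intro X Y hXY hX hY hsep
  have hA := hc.mono hij
  have hB := hc.anti hij
  have hX' : X ⊆ B i ∩ A j := hXY ▸ Finset.subset_union_left
  have hY' : Y ⊆ B i ∩ A j := hXY ▸ Finset.subset_union_right
  have hmem : ∀ v, v ∈ B i → v ∈ A j → v ∈ X ∨ v ∈ Y := by
    intro v h1 h2
    have : v ∈ X ∪ Y := hXY ▸ Finset.mem_inter.2 ⟨h1, h2⟩
    simpa using this
  have hle := h.2 i j hij hj (A i ∪ X) (Y ∪ B j) ⟨?_, ?_⟩ Finset.subset_union_left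
    (Finset.union_subset hA (hX'.trans Finset.inter_subset_right)) Finset.subset_union_right
    (Finset.union_subset (hY'.trans Finset.inter_subset_left) hB)
  · refine hle.trans (Finset.card_le_card ?_)
    intro v hv
    have := @hX v
    have := @hY v
    have := @hX' v
    have := @hY' v
    have := @hA v
    have := @hB v
    grind
  · ext v
    have := (hc.sep i).mem_or v
    have := (hc.sep j).mem_or v
    have := hmem v
    grind
  · intro u hu v hv huv
    have h1 := (hc.sep i).2 u
    have h2 := (hc.sep j).2 u
    have h3 := hsep u
    have := (hc.sep i).mem_or v
    have := (hc.sep j).mem_or u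
    have := (hc.sep i).mem_or u
    have := (hc.sep j).mem_or v
    have := hmem v
    have := hmem u
    have := @hX v
    have := @hY v
    have := @hX' u
    have := @hY' v
    have := @hA u
    have := @hB v
    have := h1
    by_cases hui : u ∈ B i
    · by_cases hvj : v ∈ A j
      · exact h3 (by grind) v (by grind) huv
      · exact h2 (by grind) v (by grind) huv
    · exact h1 (by grind) v (by grind) huv

lemma NoSmallCut.sdiff {G : SimpleGraph V} {s X Y : Finset V} {p : ℕ}
    (h : NoSmallCut G s X Y p) (hX : X ⊆ s) (hY : Y ⊆ s) (Z : Finset V) :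
    NoSmallCut G (s \ Z) (X \ Z) (Y \ Z) (p - Z.card) := by
  intro C D hCD hC hD hsep
  have hC' : C ⊆ s \ Z := hCD ▸ Finset.subset_union_left
  have hD' : D ⊆ s \ Z := hCD ▸ Finset.subset_union_right
  have hle := h (C ∪ s ∩ Z) (D ∪ s ∩ Z) ?_ ?_ ?_ ?_
  · have h1 : (C ∪ s ∩ Z) ∩ (D ∪ s ∩ Z) ⊆ (C ∩ D) ∪ Z := by
      intro v hv
      grind
    have := (Finset.card_le_card h1).trans (Finset.card_union_le _ _)
    omega
  · ext v
    have h1 : v ∈ C ∪ D ↔ v ∈ s \ Z := by rw [hCD]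
    grind
  · intro v hv
    have := @hC v
    have := hX hv
    grind
  · intro v hv
    have := @hD v
    have := hY hv
    grind
  · intro u hu v hv
    exact hsep u (by grind) v (by grind)

/-- Restricting to a union of components of `G[s]`. -/
lemma NoSmallCut.restrict {G : SimpleGraph V} {s X Y D : Finset V} {q : ℕ}
    (h : NoSmallCut G s X Y q) (hX : X ⊆ s) (hY : Y ⊆ s) (hXq : X.card = q) (hYq : Y.card = q)
    (hD : ∀ v ∈ D, v ∈ s → ∀ w ∈ s, G.Adj v w → w ∈ D) :
    (D ∩ X).card = (D ∩ Y).card ∧ NoSmallCut G (D ∩ s) (D ∩ X) (D ∩ Y) (D ∩ X).card := by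
  have eX := Finset.card_sdiff_add_card_inter X D
  have eY := Finset.card_sdiff_add_card_inter Y D
  rw [Finset.inter_comm] at eX eY
  have hle1 : (D ∩ X).card ≤ (D ∩ Y).card := by
    have h1 := h (D ∩ s ∪ X) (s \ D ∪ Y) (by grind) Finset.subset_union_right
      Finset.subset_union_right ?_
    · have h2 : (D ∩ s ∪ X) ∩ (s \ D ∪ Y) ⊆ (X \ D) ∪ (D ∩ Y) := by
        intro v hv
        grind
      have := (Finset.card_le_card h2).trans (Finset.card_union_le _ _)
      omega
    · intro u hu v hv huv
      have := hD u (by grind) (by grind) v (by grind) huv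
      grind
  have hle2 : (D ∩ Y).card ≤ (D ∩ X).card := by
    have h1 := h (s \ D ∪ X) (D ∩ s ∪ Y) (by grind) Finset.subset_union_right
      Finset.subset_union_right ?_
    · have h2 : (s \ D ∪ X) ∩ (D ∩ s ∪ Y) ⊆ (Y \ D) ∪ (D ∩ X) := by
        intro v hv
        grind
      have := (Finset.card_le_card h2).trans (Finset.card_union_le _ _)
      omega
    · intro u hu v hv huv
      have := hD v (by grind) (by grind) u (by grind) huv.symm
      grind
  refine ⟨le_antisymm hle1 hle2, fun C E hCE hC hE hsep => ?_⟩
  have hC' : C ⊆ D ∩ s := hCE ▸ Finset.subset_union_left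
  have hE' : E ⊆ D ∩ s := hCE ▸ Finset.subset_union_right
  have hm : ∀ v, v ∈ C ∪ E ↔ v ∈ D ∩ s := fun v => by rw [hCE]
  have h1 := h (C ∪ s \ D) (E ∪ Y \ D) ?_ ?_ ?_ ?_
  · have h2 : (C ∪ s \ D) ∩ (E ∪ Y \ D) ⊆ (C ∩ E) ∪ (Y \ D) := by
      intro v hv
      grind
    have := (Finset.card_le_card h2).trans (Finset.card_union_le _ _)
    omega
  · ext v
    have := hm v
    have := @hY v
    grind
  · intro v hv
    have := hX hv
    have := @hC v
    grind
  · intro v hv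
    have := @hE v
    grind
  · intro u hu v hv huv
    have hvD : v ∈ D := by grind
    have := hD v hvD (by grind) u (by grind) huv.symm
    exact hsep u (by grind) v (by grind) huv

/-- A subgraph `G[r]` traversing the separations `(A i, B i)` with `a ≤ i ≤ b` in disjoint
adhesion sets of size `q`, attached between `a` and `b` only to `Z`. -/
structure IsTrack (G : SimpleGraph V) (A B : ℕ → Finset V) (a b : ℕ) (r Z : Finset V)
    (q : ℕ) : Prop where
  disj : Disjoint r Z
  closed : ∀ v ∈ r, ∀ w ∉ r, w ∉ Z → v ∈ B a ∩ A b → w ∈ B a ∩ A b → ¬ G.Adj v w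
  card : ∀ i, a ≤ i → i ≤ b → (r ∩ (A i ∩ B i)).card = q
  adh_disj : ∀ i j, a ≤ i → i < j → j ≤ b → Disjoint (r ∩ (A i ∩ B i)) (r ∩ (A j ∩ B j))
  cut : ∀ i j, a ≤ i → i ≤ j → j ≤ b →
    NoSmallCut G (r ∩ (B i ∩ A j)) (r ∩ (A i ∩ B i)) (r ∩ (A j ∩ B j)) q

/-- `D` is a component of the segment of `G[r]` between the separations `i` and `j` that
contains both adhesion sets and has neighbours of every vertex of `Z`. -/
structure IsBridge (G : SimpleGraph V) (A B : ℕ → Finset V) (r Z : Finset V) (i j : ℕ)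
    (D : Finset V) : Prop where
  subset : D ⊆ r ∩ (B i ∩ A j)
  conn : (G.induce (D : Set V)).Connected
  closed : ∀ v ∈ D, ∀ w ∈ r ∩ (B i ∩ A j), G.Adj v w → w ∈ D
  left : r ∩ (A i ∩ B i) ⊆ D
  right : r ∩ (A j ∩ B j) ⊆ D
  sun : ∀ z ∈ Z, ∃ y ∈ D, G.Adj z y

lemma inter_inter_subset_segment {A B : ℕ → Finset V} (hA : Monotone A) (hB : Antitone B)
    (r : Finset V) {i j : ℕ} (hij : i ≤ j) :
    r ∩ (A i ∩ B i) ⊆ r ∩ (B i ∩ A j) ∧ r ∩ (A j ∩ B j) ⊆ r ∩ (B i ∩ A j) := by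
  have h1 := hA hij
  have h2 := hB hij
  constructor
  · intro v hv
    have := @h1 v
    grind
  · intro v hv
    have := @h2 v
    grind

lemma IsTrack.restrict {G : SimpleGraph V} {A B : ℕ → Finset V} {a b a' b' : ℕ}
    {r Z Z' D : Finset V} {q : ℕ} (hA : Monotone A) (hB : Antitone B)
    (h : IsTrack G A B a b r Z q) (ha : a ≤ a') (hab : a' ≤ b') (hb : b' ≤ b)
    (hD : D ⊆ r ∩ (B a' ∩ A b')) (hcl : ∀ v ∈ D, ∀ w ∈ r ∩ (B a' ∩ A b'), G.Adj v w → w ∈ D)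
    (hZ : Z' ⊆ Z) (hZ' : ∀ z ∈ Z, z ∉ Z' → ∀ y ∈ D, ¬ G.Adj z y) :
    IsTrack G A B a' b' D Z' (D ∩ (A a' ∩ B a')).card := by
  have hDr : D ⊆ r := hD.trans Finset.inter_subset_left
  have hDr' : ∀ s : Finset V, D ∩ (r ∩ s) = D ∩ s := by
    intro s
    rw [← Finset.inter_assoc, Finset.inter_eq_left.2 hDr]
  have key : ∀ i j, a' ≤ i → i ≤ j → j ≤ b' →
      (D ∩ (A i ∩ B i)).card = (D ∩ (A j ∩ B j)).card ∧
      NoSmallCut G (D ∩ (B i ∩ A j)) (D ∩ (A i ∩ B i)) (D ∩ (A j ∩ B j))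
        (D ∩ (A i ∩ B i)).card := by
    intro i j hi hij hj
    have h1 := (h.cut i j (ha.trans hi) hij (hj.trans hb)).restrict (D := D)
      (inter_inter_subset_segment hA hB r hij).1 (inter_inter_subset_segment hA hB r hij).2
      (h.card i (by omega) (by omega)) (h.card j (by omega) (by omega)) ?_
    · simpa only [hDr'] using h1
    · intro v hv hvs w hw
      have h2 := @hA j b' hj w
      have h3 := @hB a' i hi w
      exact hcl v hv w (by grind)
  have hcard : ∀ i, a' ≤ i → i ≤ b' → (D ∩ (A a' ∩ B a')).card = (D ∩ (A i ∩ B i)).card :=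
    fun i hi hi' => (key a' i le_rfl hi hi').1
  refine ⟨?_, ?_, fun i hi hi' => (hcard i hi hi').symm, ?_, ?_⟩
  · exact Finset.disjoint_of_subset_left hDr (Finset.disjoint_of_subset_right hZ h.disj)
  · intro v hv w hw hwZ hv' hw' hvw
    by_cases hwr : w ∈ r
    · exact hw (hcl v hv w (Finset.mem_inter.2 ⟨hwr, hw'⟩) hvw)
    · by_cases hwZ' : w ∈ Z
      · exact hZ' w hwZ' hwZ v hv hvw.symm
      · have h1 : B a' ∩ A b' ⊆ B a ∩ A b := Finset.inter_subset_inter (hB ha) (hA hb)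
        exact h.closed v (hDr hv) w hwr hwZ' (h1 hv') (h1 hw') hvw
  · intro i j hi hij hj
    exact Finset.disjoint_of_subset_left (Finset.inter_subset_inter_right hDr)
      (Finset.disjoint_of_subset_right (Finset.inter_subset_inter_right hDr)
        (h.adh_disj i j (by omega) hij (by omega)))
  · intro i j hi hij hj
    rw [hcard i hi (by omega)]
    exact (key i j hi hij hj).2

/-- Every vertex of `s` lies in a connected subset of `s` that is closed under adjacency
in `s`. -/
lemma exists_component (G : SimpleGraph V) {s : Finset V} {u : V} (hu : u ∈ s) :
    ∃ D ⊆ s, u ∈ D ∧ (G.induce (D : Set V)).Connected ∧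
      ∀ v ∈ D, ∀ w ∈ s, G.Adj v w → w ∈ D := by
  classical
  have hsing : ∀ w : V, (G.induce (({w} : Finset V) : Set V)).Connected := by
    intro w
    rw [Finset.coe_singleton]
    have : Nonempty ({w} : Set V) := ⟨⟨_, rfl⟩⟩
    exact ⟨SimpleGraph.Preconnected.of_subsingleton⟩
  obtain ⟨D, hD, hmax⟩ := Finset.exists_max_image
    (s.powerset.filter fun D : Finset V => u ∈ D ∧ (G.induce (D : Set V)).Connected) Finset.card
    ⟨{u}, by simp only [Finset.mem_filter, Finset.mem_powerset]; exact ⟨by simpa, by simp, hsing u⟩⟩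
  simp only [Finset.mem_filter, Finset.mem_powerset] at hD hmax
  refine ⟨D, hD.1, hD.2.1, hD.2.2, fun v hv w hw hvw => ?_⟩
  by_contra hwD
  have h1 := hmax (D ∪ {w}) ⟨Finset.union_subset hD.1 (by simpa), by simp [hD.2.1], ?_⟩
  · rw [Finset.card_union_of_disjoint (by simpa)] at h1
    simp at h1
  · rw [Finset.coe_union]
    exact SimpleGraph.connected_induce_union hD.2.2.preconnected (hsing w).preconnected hv
      (by simp) hvw

lemma exists_bridged_track (d : ℕ) {n : ℕ} (hn : 1 ≤ n) : ∃ L : ℕ, 1 ≤ L ∧ ∀ (V : Type) [Fintype V] [DecidableEq V]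
    (G : SimpleGraph V) (A B : ℕ → Finset V), Monotone A → Antitone B →
    ∀ (a : ℕ) (r Z : Finset V) (q : ℕ), IsTrack G A B a (a + L) r Z q → 1 ≤ q →
      q + Z.card ≤ d → ∃ (a' m : ℕ) (r' Z' : Finset V) (q' : ℕ),
        IsTrack G A B a' (a' + n * m) r' Z' q' ∧ 1 ≤ m ∧ 1 ≤ q' ∧
        ∀ t < n, ∃ D, IsBridge G A B r' Z' (a' + t * m) (a' + (t + 1) * m) D := by
  induction d with
  | zero => exact ⟨1, le_rfl, fun V _ _ G A B _ _ a r Z q _ h1 h2 => by omega⟩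
  | succ d ih =>
    obtain ⟨L, hL, ih⟩ := ih
    refine ⟨n * L, Nat.mul_pos hn hL, fun V _ _ G A B hA hB a r Z q h hq hd => ?_⟩
    by_cases hgood : ∀ t < n, ∃ D, IsBridge G A B r Z (a + t * L) (a + (t + 1) * L) D
    · exact ⟨a, L, r, Z, q, h, hL, hq, hgood⟩
    push Not at hgood
    obtain ⟨t, ht, hbad⟩ := hgood
    have hj : a + (t + 1) * L = a + t * L + L := by ring
    have hjb : a + t * L + L ≤ a + n * L := by
      rw [← hj]
      exact Nat.add_le_add_left (Nat.mul_le_mul_right _ ht) _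
    rw [hj] at hbad
    set i := a + t * L with hi
    have hai : a ≤ i := by omega
    clear_value i
    have hci := h.card i hai (by omega)
    have hcj := h.card (i + L) (by omega) hjb
    obtain ⟨hsi, hsj⟩ := inter_inter_subset_segment hA hB r (Nat.le_add_right i L)
    obtain ⟨u, hu⟩ : (r ∩ (A i ∩ B i)).Nonempty := by
      rw [← Finset.card_pos]; omega
    obtain ⟨D, hDs, huD, hconn, hcl⟩ := exists_component G (hsi hu)
    have hDr : D ⊆ r := hDs.trans Finset.inter_subset_left
    have hq' : 1 ≤ (D ∩ (A i ∩ B i)).card :=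
      Finset.card_pos.2 ⟨u, by grind⟩
    have hDi : (D ∩ (A i ∩ B i)).card ≤ q :=
      hci ▸ Finset.card_le_card (Finset.inter_subset_inter_right hDr)
    by_cases hfull : r ∩ (A i ∩ B i) ⊆ D
    · have hDi' : D ∩ (A i ∩ B i) = r ∩ (A i ∩ B i) := by
        ext v
        have := @hfull v
        have := @hDr v
        grind
      have hright : r ∩ (A (i + L) ∩ B (i + L)) ⊆ D := by
        have h1 := (h.restrict hA hB hai (Nat.le_add_right i L) hjb hDs hcl
          (Finset.Subset.refl Z) (fun z hz hz' => absurd hz hz')).card (i + L)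
          (Nat.le_add_right i L) le_rfl
        have h2 : D ∩ (A (i + L) ∩ B (i + L)) = r ∩ (A (i + L) ∩ B (i + L)) := by
          apply Finset.eq_of_subset_of_card_le (Finset.inter_subset_inter_right hDr)
          rw [h1, hDi', hci, hcj]
        rw [← h2]
        exact Finset.inter_subset_left
      have : ∃ z ∈ Z, ∀ y ∈ D, ¬ G.Adj z y := by
        by_contra hno
        push Not at hno
        exact hbad D ⟨hDs, hconn, hcl, hfull, hright, hno⟩
      obtain ⟨z, hz, hzD⟩ := this
      have h1 := h.restrict hA hB hai (Nat.le_add_right i L) hjb hDs hcl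
        (Finset.erase_subset z Z) (by
          intro z' hz' hne
          have : z' = z := by grind
          rwa [this])
      refine ih V G A B hA hB i D (Z.erase z) _ h1 hq' ?_
      have := Finset.card_erase_add_one hz
      omega
    · have h1 := h.restrict hA hB hai (Nat.le_add_right i L) hjb hDs hcl
        (Finset.Subset.refl Z) (fun z hz hz' => absurd hz hz')
      refine ih V G A B hA hB i D Z _ h1 hq' ?_
      have : (D ∩ (A i ∩ B i)).card < (r ∩ (A i ∩ B i)).card := by
        refine Finset.card_lt_card ⟨Finset.inter_subset_inter_right hDr, fun hh => hfull ?_⟩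
        exact hh.trans Finset.inter_subset_left
      omega

/-- Bridges between consecutive separations of a track form an RC-decomposition. -/
lemma IsTrack.isRCDecomp {G : SimpleGraph V} {A B D : ℕ → Finset V} {r Z : Finset V}
    {M q : ℕ} (hM : 1 ≤ M) (hsep : ∀ i, IsSep G (A i) (B i)) (hA : Monotone A) (hB : Antitone B)
    (h : IsTrack G A B 0 (M + 1) r Z q)
    (hD : ∀ t ≤ M, IsBridge G A B r Z t (t + 1) (D t)) :
    ∃ r' c : Finset V, IsRCDecomp G r' Z c M q D := by
  set U : ℕ → Finset V := fun t => r ∩ (A t ∩ B t) with hU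
  have hleft : ∀ t ≤ M, U t ⊆ D t := fun t ht => (hD t ht).left
  have hright : ∀ t ≤ M, U (t + 1) ⊆ D t := fun t ht => (hD t ht).right
  have hDr : ∀ t ≤ M, ∀ v ∈ D t, v ∈ r ∧ v ∈ B t ∧ v ∈ A (t + 1) := by
    intro t ht v hv
    have := (hD t ht).subset hv
    grind
  have hUmem : ∀ t v, v ∈ U t ↔ v ∈ r ∧ v ∈ A t ∧ v ∈ B t := by
    intro t v
    simp [hU]
  have hmeet : ∀ i t j, i < t → t ≤ j → j ≤ M → ∀ v, v ∈ D i → v ∈ D j → v ∈ U t := by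
    intro i t j hi ht hj v hvi hvj
    have h1 := hDr i (by omega) v hvi
    have h2 := hDr j hj v hvj
    exact (hUmem t v).2 ⟨h1.1, hA hi h1.2.2, hB ht h2.2.1⟩
  have hcons : ∀ i, 1 ≤ i → i ≤ M → D (i - 1) ∩ D i = U i := by
    intro i hi hiM
    obtain ⟨t, rfl⟩ : ∃ t, i = t + 1 := ⟨i - 1, by omega⟩
    rw [Nat.add_sub_cancel]
    apply le_antisymm
    · intro v hv
      exact hmeet t (t + 1) (t + 1) (by omega) le_rfl hiM v (Finset.mem_inter.1 hv).1
        (Finset.mem_inter.1 hv).2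
    · exact Finset.subset_inter (hright t (by omega)) (hleft _ hiM)
  have hcard : ∀ i ≤ M + 1, (U i).card = q := fun i hi => h.card i (by omega) hi
  have hdisj : ∀ i j, i < j → j ≤ M + 1 → Disjoint (U i) (U j) :=
    fun i j hij hj => h.adh_disj i j (by omega) hij hj
  have hnext : ∀ i, i + 1 ≤ M → D i ∩ D (i + 1) = U (i + 1) :=
    fun i hi => hcons (i + 1) (by omega) hi
  have hne : ∀ t ≤ M, U t ≠ D t ∧ U (t + 1) ≠ D t := by
    intro t ht
    have hd := hdisj t (t + 1) (by omega) (by omega)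
    have hnon : (D t).Nonempty := by
      obtain ⟨v, hv⟩ := (hD t ht).conn.nonempty
      exact ⟨v, hv⟩
    have c1 := hcard t (by omega)
    have c2 := hcard (t + 1) (by omega)
    have hcase : ∀ X Y : Finset V, Disjoint X Y → X.card = q → Y.card = q → Y ⊆ D t →
        X ≠ D t := by
      intro X Y hXY hX hY hYD he
      rw [← he] at hYD hnon
      have hYe : Y = ∅ := (Finset.disjoint_self_iff_empty Y).1
        (Finset.disjoint_of_subset_left hYD hXY)
      have : 0 < X.card := Finset.card_pos.2 hnon
      rw [hYe] at hY
      simp at hY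
      omega
    exact ⟨hcase _ _ hd c1 c2 (hright t ht), hcase _ _ hd.symm c2 c1 (hleft t ht)⟩
  have hreach : ∀ n i j x y, (i - j) + (j - i) = n → i ≤ M → j ≤ M → x ∈ D i →
      y ∈ r → y ∈ B j → y ∈ A (j + 1) → G.Adj x y → ∃ t ≤ M, x ∈ D t ∧ y ∈ D t := by
    intro n
    induction n with
    | zero =>
      intro i j x y hn hi hj hx hyr hyB hyA hxy
      obtain rfl : i = j := by omega
      exact ⟨i, hi, hx, (hD i hi).closed x hx y
        (Finset.mem_inter.2 ⟨hyr, Finset.mem_inter.2 ⟨hyB, hyA⟩⟩) hxy⟩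
    | succ n ih =>
      intro i j x y hn hi hj hx hyr hyB hyA hxy
      obtain ⟨hxr, hxB, hxA⟩ := hDr i hi x hx
      rcases lt_or_ge i j with hij | hij
      · by_cases hy : y ∈ A (i + 1)
        · exact ⟨i, hi, hx, (hD i hi).closed x hx y (Finset.mem_inter.2 ⟨hyr,
            Finset.mem_inter.2 ⟨hB hij.le hyB, hy⟩⟩) hxy⟩
        · have hyB' : y ∈ B (i + 1) := hB hij hyB
          have hxB' : x ∈ B (i + 1) := by
            by_contra hno
            exact (hsep (i + 1)).2 x (by simp [hxA, hno]) y (by simp [hy, hyB']) hxy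
          exact ih (i + 1) j x y (by omega) (by omega) hj
            (hleft (i + 1) (by omega) ((hUmem _ _).2 ⟨hxr, hxA, hxB'⟩)) hyr hyB hyA hxy
      · obtain ⟨i, rfl⟩ : ∃ i', i = i' + 1 := ⟨i - 1, by omega⟩
        have hyA' : y ∈ A (i + 1) := hA (by omega) hyA
        by_cases hy : y ∈ B (i + 1)
        · exact ⟨i + 1, hi, hx, (hD _ hi).closed x hx y (Finset.mem_inter.2 ⟨hyr,
            Finset.mem_inter.2 ⟨hy, hA (Nat.le_succ _) hyA'⟩⟩) hxy⟩
        · have hxA' : x ∈ A (i + 1) := by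
            by_contra hno
            exact (hsep (i + 1)).2 y (by simp [hy, hyA']) x (by simp [hno, hxB]) hxy.symm
          exact ih i j x y (by omega) (by omega) hj
            (hright i (by omega) ((hUmem _ _).2 ⟨hxr, hxA', hxB⟩)) hyr hyB hyA hxy
  have hcut : ∀ t ≤ M, ExistsLinkage G (D t) (U t) (U (t + 1)) q := by
    intro t ht
    have hb := hD t ht
    have hDr' : D t ⊆ r := fun v hv => (hDr t ht v hv).1
    obtain ⟨s1, s2⟩ := inter_inter_subset_segment hA hB r (Nat.le_succ t)
    have h1 := ((h.cut t (t + 1) (by omega) (by omega) (by omega)).restrict (D := D t) s1 s2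
      (hcard t (by omega)) (hcard (t + 1) (by omega)) (fun v hv _ => hb.closed v hv)).2
    rw [Finset.inter_eq_left.2 hb.subset, Finset.inter_eq_right.2 hb.left,
      Finset.inter_eq_right.2 hb.right, h.card t (by omega) (by omega)] at h1
    exact h1.existsLinkage hb.left hb.right (hcard t (by omega)) (hcard (t + 1) (by omega))
  set R := (Finset.range (M + 1)).biUnion D with hR
  have hRmem : ∀ v, v ∈ R ↔ ∃ t ≤ M, v ∈ D t := by
    intro v
    simp [hR]
  have hU0R : U 0 ⊆ R := fun v hv => (hRmem v).2 ⟨0, by omega, hleft 0 (by omega) hv⟩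
  have hU1R : U (M + 1) ⊆ R := fun v hv => (hRmem v).2 ⟨M, le_rfl, hright M le_rfl hv⟩
  have hRr : ∀ v ∈ R, v ∈ r ∧ v ∈ B 0 ∧ v ∈ A (M + 1) := by
    intro v hv
    obtain ⟨t, ht, hvt⟩ := (hRmem v).1 hv
    obtain ⟨h1, h2, h3⟩ := hDr t ht v hvt
    exact ⟨h1, hB (Nat.zero_le t) h2, hA (by omega) h3⟩
  have hZR : Disjoint Z R :=
    (Finset.disjoint_of_subset_left (fun v hv => (hRr v hv).1) h.disj).symm
  have hexists : ∀ y ∈ r, y ∈ B 0 → y ∈ A (M + 1) → ∃ j ≤ M, y ∈ B j ∧ y ∈ A (j + 1) := by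
    intro y hyr hy0 hyM
    by_contra hno
    push Not at hno
    have : ∀ j ≤ M + 1, y ∈ B j := by
      intro j hj
      induction j with
      | zero => exact hy0
      | succ j ih =>
        have h1 := hno j (by omega) (ih (by omega))
        exact ((hsep (j + 1)).mem_or y).resolve_left h1
    exact hno M le_rfl (this M (by omega)) hyM
  have hleave : ∀ x ∈ R, x ∉ U 0 → x ∉ U (M + 1) → ∀ y ∉ R, G.Adj x y → y ∈ Z := by
    intro x hx hx0 hxM y hy hxy
    obtain ⟨hxr, hxB, hxA⟩ := hRr x hx
    have hx0' : x ∉ A 0 := fun hh => hx0 ((hUmem _ _).2 ⟨hxr, hh, hxB⟩)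
    have hxM' : x ∉ B (M + 1) := fun hh => hxM ((hUmem _ _).2 ⟨hxr, hxA, hh⟩)
    have hyB : y ∈ B 0 := by
      by_contra hno
      have := ((hsep 0).mem_or y).resolve_right hno
      exact (hsep 0).2 y (by simp [this, hno]) x (by simp [hx0', hxB]) hxy.symm
    have hyA : y ∈ A (M + 1) := by
      by_contra hno
      have := ((hsep (M + 1)).mem_or y).resolve_left hno
      exact (hsep (M + 1)).2 x (by simp [hxA, hxM']) y (by simp [this, hno]) hxy
    by_contra hyZ
    by_cases hyr : y ∈ r
    · obtain ⟨j, hj, hyj, hyj'⟩ := hexists y hyr hyB hyA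
      obtain ⟨i, hi, hxi⟩ := (hRmem x).1 hx
      obtain ⟨t, ht, -, hyt⟩ := hreach _ i j x y rfl hi hj hxi hyr hyj hyj' hxy
      exact hy ((hRmem y).2 ⟨t, ht, hyt⟩)
    · exact h.closed x hxr y hyr hyZ (Finset.mem_inter.2 ⟨hxB, hxA⟩)
        (Finset.mem_inter.2 ⟨hyB, hyA⟩) hxy
  set c := Rᶜ ∪ (U 0 ∪ U (M + 1)) with hc
  have hcmem : ∀ v, v ∈ c ↔ v ∉ R ∨ v ∈ U 0 ∨ v ∈ U (M + 1) := by
    intro v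
    simp [hc]
  have hc0 : c ∩ D 0 = U 0 := by
    ext v
    rw [Finset.mem_inter, hcmem]
    constructor
    · rintro ⟨h1 | h1 | h1, h2⟩
      · exact absurd ((hRmem v).2 ⟨0, by omega, h2⟩) h1
      · exact h1
      · have h3 := hmeet 0 1 M (by omega) hM le_rfl v h2 (hright M le_rfl h1)
        exact absurd h1 (Finset.disjoint_left.1 (hdisj 1 (M + 1) (by omega) le_rfl) h3)
    · exact fun hv => ⟨Or.inr (Or.inl hv), hleft 0 (by omega) hv⟩
  have hcM : c ∩ D M = U (M + 1) := by
    ext v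
    rw [Finset.mem_inter, hcmem]
    constructor
    · rintro ⟨h1 | h1 | h1, h2⟩
      · exact absurd ((hRmem v).2 ⟨M, le_rfl, h2⟩) h1
      · have h3 := hmeet 0 M M (by omega) le_rfl le_rfl v (hleft 0 (by omega) h1) h2
        exact absurd h3 (Finset.disjoint_left.1 (hdisj 0 M (by omega) (by omega)) h1)
      · exact h1
    · exact fun hv => ⟨Or.inr (Or.inr hv), hright M le_rfl hv⟩
  have hn0 : D 0 ∩ D 1 = U 1 := hnext 0 hM
  have hnM : D (M - 1) ∩ D M = U M := hcons M hM le_rfl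
  refine ⟨R, c, ⟨⟨⟨?_, ?_, ?_, ?_, ?_, ?_, ?_⟩, ?_, ?_, ?_⟩, ?_, ?_, ?_, ?_, ?_, ?_, ?_, ?_, ?_⟩⟩
  · exact fun i hi v hv => (hRmem v).2 ⟨i, hi, hv⟩
  · exact fun x hx => (hRmem x).1 hx
  · intro x hx y hy hxy
    obtain ⟨i, hi, hxi⟩ := (hRmem x).1 hx
    obtain ⟨j, hj, hyj⟩ := (hRmem y).1 hy
    obtain ⟨h1, h2, h3⟩ := hDr j hj y hyj
    exact hreach _ i j x y rfl hi hj hxi h1 h2 h3 hxy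
  · intro i j k hij hjk hk v hv
    rw [Finset.mem_inter] at hv
    rcases hij.eq_or_lt with rfl | hlt
    · exact hv.1
    · exact hleft j (by omega) (hmeet i j k hlt hjk hk v hv.1 hv.2)
  · intro i hi hiM
    rw [hcons i hi hiM]
    exact hcard i (by omega)
  · intro i hi hiM
    rw [hcons i hi hiM]
    have := (hne (i - 1) (by omega)).2
    rwa [Nat.sub_add_cancel hi] at this
  · intro i hi hiM
    rw [hcons i hi hiM]
    exact (hne i hiM).1
  · intro i hi hiM
    rw [hcons i hi (by omega), hnext i hiM]
    exact hcut i (by omega)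
  · exact fun i hi => (hD i hi).conn
  · intro i hi hiM
    rw [hcons i hi (by omega), hnext i hiM]
    exact hdisj i (i + 1) (by omega) (by omega)
  · intro v hv
    exact (hcmem v).2 (Or.inl (Finset.disjoint_left.1 hZR hv))
  · exact hZR
  · intro v
    have := hcmem v
    grind
  · have hone : ∀ x y, G.Adj x y → x ∈ R → y ∉ R →
        (x ∈ R ∪ Z ∧ y ∈ R ∪ Z) ∨ (x ∈ c ∧ y ∈ c) := by
      intro x y hxy hx hy
      by_cases hxc : x ∈ c
      · exact Or.inr ⟨hxc, (hcmem y).2 (Or.inl hy)⟩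
      · rw [hcmem] at hxc
        push Not at hxc
        exact Or.inl ⟨by simp [hx], Finset.mem_union_right _
          (hleave x hx hxc.2.1 hxc.2.2 y hy hxy)⟩
    intro x y hxy
    by_cases hx : x ∈ R <;> by_cases hy : y ∈ R
    · exact Or.inl ⟨by simp [hx], by simp [hy]⟩
    · exact hone x y hxy hx hy
    · have := hone y x hxy.symm hy hx
      tauto
    · exact Or.inr ⟨(hcmem x).2 (Or.inl hx), (hcmem y).2 (Or.inl hy)⟩
  · rw [hc0, hcM]
    ext v
    have := hcmem v
    have := @hU0R v
    have := @hU1R v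
    grind
  · rw [hc0, hcM]
    exact ⟨hcard 0 (by omega), hcard (M + 1) le_rfl⟩
  · rw [hc0, hcM, hn0, hnM]
    exact ⟨hdisj 0 1 (by omega) (by omega), hdisj M (M + 1) (by omega) le_rfl⟩
  · rw [hc0, hcM, hn0, hnM]
    exact ⟨hcut 0 (by omega), hcut M le_rfl⟩
  · exact fun i hi x hx => (hD i hi).sun x hx

/-- Passing to a subsequence of the separations. -/
lemma IsTrack.comp {G : SimpleGraph V} {A B : ℕ → Finset V} {r Z : Finset V} {a b n q : ℕ}
    {f : ℕ → ℕ} (h : IsTrack G A B a b r Z q) (hf : Monotone f) (hlt : ∀ i < n, f i < f (i + 1))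
    (h0 : f 0 = a) (hn : f n = b) : IsTrack G (fun t => A (f t)) (fun t => B (f t)) 0 n r Z q := by
  have ha : ∀ i, a ≤ f i := fun i => h0 ▸ hf (Nat.zero_le i)
  have hb : ∀ i ≤ n, f i ≤ b := fun i hi => hn ▸ hf hi
  refine ⟨h.disj, ?_, fun i _ hi => h.card _ (ha i) (hb i hi), fun i j _ hij hj => ?_,
    fun i j _ hij hj => h.cut _ _ (ha i) (hf hij) (hb j hj)⟩
  · simp only [h0, hn]
    exact h.closed
  · exact h.adh_disj _ _ (ha i) ((hlt i (by omega)).trans_le (hf hij)) (hb j hj)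

lemma adhesion_inter_subset {A B : ℕ → Finset V} (hA : Monotone A) (hB : Antitone B)
    {i j l : ℕ} (hij : i ≤ j) (hjl : j ≤ l) : (A i ∩ B i) ∩ (A l ∩ B l) ⊆ A j ∩ B j := by
  intro v hv
  have := @hA i j hij v
  have := @hB j l hjl v
  grind

/-- Homogenisation of the intersections of consecutive adhesion sets. -/
lemma exists_sunflower (d : ℕ) {n : ℕ} (hn : 1 ≤ n) : ∃ L : ℕ, 1 ≤ L ∧
    ∀ (V : Type) [Fintype V] [DecidableEq V] (A B : ℕ → Finset V), Monotone A → Antitone B →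
    ∀ a p : ℕ, (∀ i, a ≤ i → i ≤ a + L → (A i ∩ B i).card = p) →
      p ≤ ((A a ∩ B a) ∩ (A (a + L) ∩ B (a + L))).card + d →
      ∃ (a' m : ℕ) (Z : Finset V), 1 ≤ m ∧ a' + n * m ≤ a + L ∧ a ≤ a' ∧
        ∀ t < n, (A (a' + t * m) ∩ B (a' + t * m)) ∩
          (A (a' + (t + 1) * m) ∩ B (a' + (t + 1) * m)) = Z := by
  induction d with
  | zero =>
    refine ⟨n, hn, fun V _ _ A B hA hB a p hp hZ =>
      ⟨a, 1, A a ∩ B a, le_rfl, by omega, le_rfl, fun t ht => ?_⟩⟩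
    have key : ∀ i, i ≤ n → A (a + i) ∩ B (a + i) = A a ∩ B a := by
      have h0 : (A a ∩ B a) ∩ (A (a + n) ∩ B (a + n)) = A a ∩ B a :=
        Finset.eq_of_subset_of_card_le Finset.inter_subset_left
          (by have := hp a le_rfl (by omega); omega)
      intro i hi
      symm
      refine Finset.eq_of_subset_of_card_le ?_
        (by rw [hp a le_rfl (by omega), hp (a + i) (by omega) (by omega)])
      have := adhesion_inter_subset hA hB (Nat.le_add_right a i) (Nat.add_le_add_left hi a)
      rwa [h0] at this
    rw [mul_one, mul_one, key t (by omega), key (t + 1) (by omega), Finset.inter_self]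
  | succ d ih =>
    obtain ⟨L, hL, ih⟩ := ih
    refine ⟨n * L, Nat.mul_pos hn hL, fun V _ _ A B hA hB a p hp hZ => ?_⟩
    by_cases hgood : ∀ t < n, (A (a + t * L) ∩ B (a + t * L)) ∩
          (A (a + (t + 1) * L) ∩ B (a + (t + 1) * L)) =
          (A a ∩ B a) ∩ (A (a + n * L) ∩ B (a + n * L))
    · exact ⟨a, L, _, hL, le_rfl, le_rfl, hgood⟩
    push Not at hgood
    obtain ⟨t, ht, hbad⟩ := hgood
    have hj : a + (t + 1) * L = a + t * L + L := by ring
    have hjb : a + t * L + L ≤ a + n * L := by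
      rw [← hj]
      exact Nat.add_le_add_left (Nat.mul_le_mul_right _ ht) _
    rw [hj] at hbad
    have hsub : (A a ∩ B a) ∩ (A (a + n * L) ∩ B (a + n * L)) ⊆
        (A (a + t * L) ∩ B (a + t * L)) ∩ (A (a + t * L + L) ∩ B (a + t * L + L)) :=
      Finset.subset_inter (adhesion_inter_subset hA hB (by omega) (by omega))
        (adhesion_inter_subset hA hB (by omega) (by omega))
    have hlt := Finset.card_lt_card
      (Finset.ssubset_iff_subset_ne.2 ⟨hsub, fun he => hbad he.symm⟩)
    obtain ⟨a', m, Z, h1, h2, h3, h4⟩ := ih V A B hA hB (a + t * L) p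
      (fun i hi hi' => hp i (by omega) (by omega)) (by omega)
    exact ⟨a', m, Z, h1, by omega, by omega, h4⟩

lemma exists_strictMono_enum (T : Finset ℕ) {m : ℕ} (hT : m < T.card) :
    ∃ f : ℕ → ℕ, Monotone f ∧ (∀ i < m, f i < f (i + 1)) ∧ ∀ i, f i ∈ T := by
  refine ⟨fun i => T.orderEmbOfFin rfl ⟨min i m, by omega⟩, fun i j hij => ?_, fun i hi => ?_,
    fun i => Finset.orderEmbOfFin_mem _ _ _⟩
  · simp only [OrderEmbedding.le_iff_le, Fin.mk_le_mk]
    exact min_le_min_right m hij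
  · simp only [OrderEmbedding.lt_iff_lt, Fin.mk_lt_mk]
    omega

/-- In a connected graph every proper nonempty vertex set has a neighbour. -/
lemma exists_adj_not_mem {G : SimpleGraph V} (hG : G.Connected) {K : Finset V} {u v : V}
    (hu : u ∈ K) (hv : v ∉ K) : ∃ x ∈ K, ∃ y ∉ K, G.Adj x y := by
  obtain ⟨p⟩ := hG.preconnected u v
  obtain ⟨d, _, h1, h2⟩ := p.exists_boundary_dart (K : Set V) hu hv
  exact ⟨d.fst, h1, d.snd, h2, d.adj⟩

/-- The case in which all adhesion sets coincide. -/
lemma exists_isRCDecomp_of_const {G : SimpleGraph V} (hG : G.Connected) {w n M : ℕ}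
    (hM : 1 ≤ M) (hn : 2 ^ w * (M + 1) < n) {A B : ℕ → Finset V} {Z : Finset V}
    (hc : IsSepChain G w n A B) (hU : ∀ i ≤ n, A i ∩ B i = Z) :
    ∃ (r z c : Finset V) (W : ℕ → Finset V), IsRCDecomp G r z c M 0 W ∧ 1 ≤ z.card := by
  classical
  have hK : ∀ i < n, ∃ K ⊆ A (i + 1) \ A i, (G.induce (K : Set V)).Connected ∧
      ∀ v ∈ K, ∀ x ∉ Z, G.Adj v x → x ∈ K := by
    intro i hi
    obtain ⟨u, hu⟩ : (A (i + 1) \ A i).Nonempty := by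
      rw [Finset.sdiff_nonempty]
      exact fun h => hc.strict i hi (le_antisymm (hc.mono (Nat.le_succ i)) h)
    obtain ⟨K, hKs, _, hconn, hcl⟩ := exists_component G hu
    refine ⟨K, hKs, hconn, fun v hv x hx hvx => hcl v hv x ?_ hvx⟩
    have hvs := hKs hv
    have e1 := hU i hi.le
    have e2 := hU (i + 1) hi
    have m1 := (hc.sep i).mem_or x
    have m2 := (hc.sep (i + 1)).mem_or x
    have m3 := (hc.sep i).mem_or v
    have n1 := (hc.sep i).2 x
    have n2 := (hc.sep (i + 1)).2 v
    have a1 : A i ⊆ A (i + 1) := hc.mono (Nat.le_succ i)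
    have hvZ : v ∉ Z := by
      rw [← e1]; grind
    have hvB : v ∉ B (i + 1) := by
      intro h; apply hvZ; rw [← e2]; grind
    have hx1 : x ∈ A (i + 1) := by
      by_contra h
      exact n2 (by grind) x (by grind) hvx
    have hx2 : x ∉ A i := by
      intro h
      have : x ∉ B i := fun h' => hx (by rw [← e1]; grind)
      exact n1 (by grind) v (by grind) hvx.symm
    grind
  choose! K hKs hKc hKcl using hK
  set N : ℕ → Finset V := fun i => Z.filter fun z => ∃ y ∈ K i, G.Adj z y with hN
  have hZw : Z.card < w := by
    rw [← hU 0 (by omega)]; exact hc.card_lt 0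
  obtain ⟨S, hS, hT⟩ := Finset.exists_lt_card_fiber_of_mul_lt_card_of_maps_to
    (s := Finset.range n) (t := Z.powerset) (f := N) (n := M + 1)
    (fun i _ => Finset.mem_powerset.2 (Finset.filter_subset _ _)) (by
      rw [Finset.card_powerset, Finset.card_range]
      refine lt_of_le_of_lt (Nat.mul_le_mul_right _ ?_) hn
      exact Nat.pow_le_pow_right (by omega) hZw.le)
  obtain ⟨f, hf, hfs, hfT⟩ := exists_strictMono_enum _ hT
  have hfn : ∀ i, f i < n := fun i => by
    have := hfT i
    simp only [Finset.mem_filter, Finset.mem_range] at this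
    exact this.1
  have hfN : ∀ i, N (f i) = S := fun i => by
    have := hfT i
    simp only [Finset.mem_filter] at this
    exact this.2
  have hKZ : ∀ i < n, ∀ v ∈ K i, v ∉ Z := by
    intro i hi v hv
    rw [← hU i hi.le]
    have := hKs i hi hv
    grind
  set r : Finset V := (Finset.range (M + 1)).biUnion fun t => K (f t) with hr
  have hmr : ∀ v, v ∈ r ↔ ∃ t ≤ M, v ∈ K (f t) := by
    intro v
    simp [hr]
  have hrZ : ∀ v ∈ r, v ∉ Z := by
    intro v hv
    obtain ⟨t, _, hv⟩ := (hmr v).1 hv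
    exact hKZ _ (hfn t) v hv
  have hSZ : S ⊆ Z := Finset.mem_powerset.1 hS
  have hrU : ∀ i, r ∩ (A (f i) ∩ B (f i)) = ∅ := by
    intro i
    rw [hU _ (hfn i).le, ← Finset.disjoint_iff_inter_eq_empty, Finset.disjoint_left]
    exact hrZ
  have htrack : IsTrack G (fun t => A (f t)) (fun t => B (f t)) 0 (M + 1) r S 0 := by
    refine ⟨?_, ?_, fun i _ _ => by simp only [hrU, Finset.card_empty],
      fun i j _ _ _ => by simp only [hrU, Finset.disjoint_empty_left],
      fun i j _ _ _ _ _ _ _ _ _ => Nat.zero_le _⟩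
    · rw [Finset.disjoint_left]
      exact fun v hv hvS => hrZ v hv (hSZ hvS)
    · intro v hv x hx hxS _ _ hvx
      obtain ⟨t, ht, hv⟩ := (hmr v).1 hv
      by_cases hxZ : x ∈ Z
      · apply hxS
        rw [← hfN t]
        exact Finset.mem_filter.2 ⟨hxZ, v, hv, hvx.symm⟩
      · exact hx ((hmr x).2 ⟨t, ht, hKcl _ (hfn t) v hv x hxZ hvx⟩)
  have hbridge : ∀ t ≤ M, IsBridge G (fun t => A (f t)) (fun t => B (f t)) r S t (t + 1)
      (K (f t)) := by
    intro t ht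
    refine ⟨?_, hKc _ (hfn t), ?_, by simp only [hrU, Finset.empty_subset],
      by simp only [hrU, Finset.empty_subset], ?_⟩
    · intro v hv
      have h1 := hKs _ (hfn t) hv
      have h2 := hc.mono (Nat.succ_le_of_lt (hfs t (by omega)))
      have h3 := (hc.sep (f t)).mem_or v
      have h4 := (hmr v).2 ⟨t, ht, hv⟩
      have h5 := @h2 v
      grind
    · intro v hv x hx hvx
      exact hKcl _ (hfn t) v hv x (hrZ x (Finset.mem_inter.1 hx).1) hvx
    · intro z hz
      rw [← hfN t] at hz
      exact (Finset.mem_filter.1 hz).2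
  obtain ⟨r', c, h⟩ := htrack.isRCDecomp hM (fun i => hc.sep _)
    (fun i j hij => hc.mono (hf hij)) (fun i j hij => hc.anti (hf hij)) hbridge
  refine ⟨r', S, c, _, h, Finset.card_pos.2 ?_⟩
  obtain ⟨u, hu⟩ := (hKc _ (hfn 0)).nonempty
  obtain ⟨v, hv⟩ := (hKc _ (hfn 1)).nonempty
  have hu' : u ∈ K (f 0) := hu
  have hv' : v ∈ K (f 1) := hv
  obtain ⟨x, hx, y, hy, hxy⟩ := exists_adj_not_mem hG hu' (v := v) (by
    intro h
    have h1 := hKs _ (hfn 0) h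
    have h2 := hKs _ (hfn 1) hv'
    have h3 : A (f 0 + 1) ⊆ A (f 1) := hc.mono (Nat.succ_le_of_lt (hfs 0 (by omega)))
    have h4 := @h3 v
    grind)
  refine ⟨y, ?_⟩
  have hyZ : y ∈ Z := by
    by_contra h
    exact hy (hKcl _ (hfn 0) x hx y h hxy)
  rw [← hfN 0]
  exact Finset.mem_filter.2 ⟨hyZ, x, hx, hxy.symm⟩

/-- The case in which the adhesion sets have a proper common part. -/
lemma exists_isRCDecomp_of_linked (w : ℕ) {M : ℕ} (hM : 1 ≤ M) : ∃ L : ℕ,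
    ∀ (V : Type) [Fintype V] [DecidableEq V] (G : SimpleGraph V) (A B : ℕ → Finset V)
      (p n : ℕ) (Z : Finset V), IsSepChain G w n A B → IsLinkedChain G p L A B → Z.card < p →
      (∀ i j, i < j → j ≤ L → (A i ∩ B i) ∩ (A j ∩ B j) = Z) →
      ∃ (ℓ : ℕ) (r z c : Finset V) (W : ℕ → Finset V), IsRCDecomp G r z c M ℓ W ∧ 1 ≤ ℓ := by
  obtain ⟨L, hL, h⟩ := exists_bridged_track w (n := M + 1) (by omega)
  refine ⟨L, fun V _ _ G A B p n Z hc hl hZp hZ => ?_⟩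
  have hZU : ∀ i ≤ L, Z ⊆ A i ∩ B i := by
    intro i hi
    rcases Nat.eq_zero_or_pos i with rfl | hi'
    · rw [← hZ 0 1 (by omega) (by omega)]
      exact Finset.inter_subset_left
    · rw [← hZ 0 i hi' hi]
      exact Finset.inter_subset_right
  have hcompl : ∀ s : Finset V, (Finset.univ \ Z) ∩ s = s \ Z := by
    intro s
    ext v
    simp [and_comm]
  have htrack : IsTrack G A B 0 (0 + L) (Finset.univ \ Z) Z (p - Z.card) := by
    refine ⟨Finset.sdiff_disjoint, fun v _ x hx hxZ => ?_, fun i _ hi => ?_,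
      fun i j _ hij hj => ?_, fun i j _ hij hj => ?_⟩
    · exact absurd (by simpa using hxZ) hx
    · rw [hcompl, Finset.card_sdiff_of_subset (hZU i (by omega)), hl.1 i (by omega)]
    · rw [hcompl, hcompl, Finset.disjoint_left]
      intro v hv hv'
      have := hZ i j hij (by omega)
      simp only [Finset.mem_sdiff] at hv hv'
      apply hv.2
      rw [← this]
      exact Finset.mem_inter.2 ⟨hv.1, hv'.1⟩
    · simp only [hcompl]
      have e1 := hc.mono hij
      have e2 := hc.anti hij
      exact (hl.noSmallCut hc hij (by omega)).sdiff (by grind) (by grind) Z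
  have hpw : p < w := by
    rw [← hl.1 0 (by omega)]
    exact hc.card_lt 0
  obtain ⟨a, m, r, Z', q, htr, hm, hq, hD⟩ :=
    h V G A B hc.mono hc.anti 0 _ Z _ htrack (by omega) (by omega)
  have hmono : Monotone fun t => a + t * m :=
    fun i j hij => Nat.add_le_add_left (Nat.mul_le_mul_right _ hij) _
  choose! D hD using hD
  have h1 := htr.comp (f := fun t => a + t * m) hmono
    (fun i _ => by simp only [add_mul]; omega) (by simp) rfl
  obtain ⟨r', c, h2⟩ := h1.isRCDecomp (D := D) hM (fun i => hc.sep _)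
    (fun i j hij => hc.mono (hmono hij)) (fun i j hij => hc.anti (hmono hij))
    (fun t ht => by
      have := hD t (by omega)
      exact ⟨this.subset, this.conn, this.closed, this.left, this.right, this.sun⟩)
  exact ⟨q, r', Z', c, D, h2, hq⟩

/-- For all `k, M ≥ 1` there is an `N ≥ 1` such that every connected graph with at least `N`
vertices and no `(k+1)`-tangle admits an RC-decomposition of length at least `M` and adhesion
`ℓ` with `|Z| + ℓ ≥ 1`. -/
theorem stmt16 (k M : ℕ) (hk : 1 ≤ k) (hM : 1 ≤ M) :
    ∃ N : ℕ, 1 ≤ N ∧ ∀ (V : Type) [Fintype V] [DecidableEq V] (G : SimpleGraph V),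
      G.Connected → N ≤ Fintype.card V →
      (¬ ∃ τ : Set (Finset V × Finset V), IsTangle G (k + 1) τ) →
      ∃ (M' ℓ : ℕ) (r z c : Finset V) (W : ℕ → Finset V),
        M ≤ M' ∧ IsRCDecomp G r z c M' ℓ W ∧ 1 ≤ z.card + ℓ := by
  obtain ⟨L₃, h₃⟩ := exists_isRCDecomp_of_linked (3 * k + 2) hM
  set n := L₃ + (2 ^ (3 * k + 2) * (M + 1) + 1) with hn
  obtain ⟨L₁, hL₁, h₁⟩ := exists_sunflower (3 * k + 2) (n := n) (by omega)
  obtain ⟨L₂, h₂⟩ := exists_linkedChain (3 * k + 2) L₁ hL₁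
  refine ⟨2 ^ L₂ * (3 * k + 1) + 1, by omega, fun V _ _ G hG hV htangle => ?_⟩
  obtain ⟨A₀, B₀, hc₀⟩ := exists_sepChain htangle L₂ (by omega)
  obtain ⟨p, A₁, B₁, hp, hc₁, hl₁⟩ := h₂ V G A₀ B₀ hc₀
  obtain ⟨a, m, Z, hm, ham, -, hZ⟩ := h₁ V A₁ B₁ hc₁.mono hc₁.anti 0 p
    (fun i _ hi => hl₁.1 i (by omega)) (by omega)
  have hmono : ∀ {i j}, i ≤ j → a + i * m ≤ a + j * m :=
    fun hij => Nat.add_le_add_left (Nat.mul_le_mul_right _ hij) _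
  have hle : ∀ i ≤ n, a + i * m ≤ L₁ := fun i hi => by
    have := hmono hi
    omega
  set A : ℕ → Finset V := fun t => A₁ (a + t * m)
  set B : ℕ → Finset V := fun t => B₁ (a + t * m)
  have hc : IsSepChain G (3 * k + 2) n A B := by
    refine ⟨fun i => hc₁.sep _, fun i j hij => hc₁.mono (hmono hij),
      fun i j hij => hc₁.anti (hmono hij), fun i => hc₁.card_lt _, fun i hi he => ?_⟩
    have h1 : a + i * m + 1 ≤ a + (i + 1) * m := by
      rw [add_mul]; omega
    have h2 := hle (i + 1) hi
    refine hc₁.strict (a + i * m) (by omega)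
      (le_antisymm (hc₁.mono (Nat.le_succ _)) ((hc₁.mono h1).trans ?_))
    exact he.ge
  have hl : IsLinkedChain G p n A B :=
    ⟨fun i hi => hl₁.1 _ (hle i hi), fun i j hij hj => hl₁.2 _ _ (hmono hij) (hle j hj)⟩
  have hZ' : ∀ i j, i < j → j ≤ n → (A i ∩ B i) ∩ (A j ∩ B j) = Z := by
    have hsub : ∀ i ≤ n, Z ⊆ A i ∩ B i := by
      intro i hi
      rcases Nat.lt_or_ge i n with h | h
      · rw [← hZ i h]
        exact Finset.inter_subset_left
      · obtain ⟨j, rfl⟩ : ∃ j, i = j + 1 := ⟨i - 1, by omega⟩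
        rw [← hZ j (by omega)]
        exact Finset.inter_subset_right
    intro i j hij hj
    refine le_antisymm ?_ (Finset.subset_inter (hsub i (by omega)) (hsub j hj))
    rw [← hZ i (by omega)]
    exact Finset.subset_inter Finset.inter_subset_left
      (adhesion_inter_subset hc.mono hc.anti (Nat.le_succ i) hij)
  have hZU : ∀ i ≤ n, Z ⊆ A i ∩ B i := by
    intro i hi
    rcases Nat.lt_or_ge i n with h | h
    · rw [← hZ' i n h le_rfl]
      exact Finset.inter_subset_left
    · rw [← hZ' 0 i (by omega) hi]
      exact Finset.inter_subset_right
  rcases Nat.lt_or_ge Z.card p with hZp | hZp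
  · obtain ⟨ℓ, r, z, c, W, h, hℓ⟩ := h₃ V G A B p n Z hc
      ⟨fun i hi => hl.1 i (by omega), fun i j hij hj => hl.2 i j hij (by omega)⟩ hZp
      (fun i j hij hj => hZ' i j hij (by omega))
    exact ⟨M, ℓ, r, z, c, W, le_rfl, h, by omega⟩
  · obtain ⟨r, z, c, W, h, hz⟩ := exists_isRCDecomp_of_const hG (n := n) hM (by omega) hc
      (fun i hi => (Finset.eq_of_subset_of_card_le (hZU i hi)
        (by rw [hl.1 i hi]; exact hZp)).symm)
    exact ⟨M, 0, r, z, c, W, le_rfl, h, by omega⟩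
end

section
/- Let {A,B} be a separation of a graph G of order k and let W = (W_0,…,W_M) be a linear decomposition of a subgraph R of G satisfying (R3). Then the separator A ∩ B meets at most 2k bags of W. Moreover, if W additionally satisfies (R2), then at most 2k bags of W are not contained in either A \ B or B \ A. -/
open Finset

variable {V : Type} [Fintype V] [DecidableEq V]

/-- `W` is a linear decomposition of length `M` and adhesion `ℓ` of the graph `R` with vertex
set `r` (the bags cover the vertex set `r` and the edges of `R`). -/
structure IsLinDecompOf (R : SimpleGraph V) (r : Finset V) (M ℓ : ℕ)
    (W : ℕ → Finset V) : Prop where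
  subset_r : ∀ i ≤ M, W i ⊆ r
  coverV : ∀ x ∈ r, ∃ i ≤ M, x ∈ W i
  coverE : ∀ x y : V, R.Adj x y → ∃ i ≤ M, x ∈ W i ∧ y ∈ W i
  nested : ∀ i j h : ℕ, i ≤ j → j ≤ h → h ≤ M → W i ∩ W h ⊆ W j
  adhesion : ∀ i, 1 ≤ i → i ≤ M → (W (i - 1) ∩ W i).card = ℓ
  ne_left : ∀ i, 1 ≤ i → i ≤ M → W (i - 1) ∩ W i ≠ W (i - 1)
  ne_right : ∀ i, 1 ≤ i → i ≤ M → W (i - 1) ∩ W i ≠ W i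

/-- Property (R3) forces every vertex to lie in at most two bags. -/
theorem IsLinDecompOf.card_bags_mem_le_two {R : SimpleGraph V} {r : Finset V} {M ℓ : ℕ}
    {W : ℕ → Finset V} (hW : IsLinDecompOf R r M ℓ W)
    (hR3 : ∀ i, 1 ≤ i → i + 1 ≤ M → Disjoint (W (i - 1) ∩ W i) (W i ∩ W (i + 1))) (x : V) :
    ((Finset.range (M + 1)).filter fun i => x ∈ W i).card ≤ 2 := by
  set S := (Finset.range (M + 1)).filter fun i => x ∈ W i with hS
  rcases S.eq_empty_or_nonempty with h | h
  · simp [h]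
  have hm := (Finset.mem_filter.1 (S.min'_mem h)).2
  have hsub : S ⊆ Finset.Icc (S.min' h) (S.min' h + 1) := by
    intro j hj
    have hle := S.min'_le j hj
    generalize S.min' h = m at hm hle ⊢
    obtain ⟨hjM, hxj⟩ := Finset.mem_filter.1 hj
    rw [Finset.mem_range] at hjM
    rw [Finset.mem_Icc]
    refine ⟨hle, ?_⟩
    by_contra! hlt
    have between : ∀ t, m ≤ t → t ≤ j → x ∈ W t := fun t h₁ h₂ =>
      hW.nested m t j h₁ h₂ (by omega) (Finset.mem_inter.2 ⟨hm, hxj⟩)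
    have h₁ := between (m + 1) (by omega) (by omega)
    have h₂ := between (m + 1 + 1) (by omega) (by omega)
    exact Finset.disjoint_left.1 (hR3 (m + 1) (by omega) (by omega))
      (Finset.mem_inter.2 ⟨hm, h₁⟩) (Finset.mem_inter.2 ⟨h₁, h₂⟩)
  refine (Finset.card_le_card hsub).trans ?_
  simp
  omega

/-- A vertex set which is connected in a subgraph and avoids the separator of a separation lies
strictly on one side. -/
theorem IsSep.subset_or_subset_of_connected {G R : SimpleGraph V} (hRG : R ≤ G)
    {A B S : Finset V} (hAB : IsSep G A B) (hS : (R.induce (S : Set V)).Connected)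
    (hdisj : ¬ ((A ∩ B) ∩ S).Nonempty) : S ⊆ A \ B ∨ S ⊆ B \ A := by
  have side : ∀ x ∈ S, x ∈ A \ B ∨ x ∈ B \ A := by
    intro x hx
    have hu : x ∈ A ∪ B := by rw [hAB.1]; exact Finset.mem_univ x
    have hn : x ∉ (A ∩ B) ∩ S := fun h => hdisj ⟨x, h⟩
    simp only [Finset.mem_union, Finset.mem_inter, Finset.mem_sdiff] at *
    tauto
  have adj : ∀ x y : (S : Set V), (R.induce (S : Set V)).Adj x y →
      ((x : V) ∈ A \ B ↔ (y : V) ∈ A \ B) := by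
    intro x y hxy
    have h : G.Adj x y := hRG hxy
    constructor
    · intro hx
      exact (side y y.2).resolve_right fun hy => hAB.2 _ hx _ hy h
    · intro hy
      exact (side x x.2).resolve_right fun hx => hAB.2 _ hy _ hx h.symm
  have const : ∀ x y : (S : Set V), ((x : V) ∈ A \ B ↔ (y : V) ∈ A \ B) := by
    intro x y
    obtain ⟨p⟩ := hS.preconnected x y
    induction p with
    | nil => exact Iff.rfl
    | cons h _ ih => exact (adj _ _ h).trans ih
  obtain ⟨x⟩ := hS.nonempty
  by_cases hx : (x : V) ∈ A \ B
  · exact Or.inl fun y hy => (const x ⟨y, hy⟩).1 hx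
  · exact Or.inr fun y hy => (side y hy).resolve_left fun h => hx ((const x ⟨y, hy⟩).2 h)

/-- Let `{A, B}` be a separation of `G` of order `k` and let `W` be a linear decomposition of
a subgraph `R` of `G` satisfying (R3).  Then `A ∩ B` meets at most `2k` bags of `W`; moreover,
if `W` also satisfies (R2), then at most `2k` bags of `W` are contained in neither `A \ B` nor
`B \ A`. -/
theorem stmt17 (G R : SimpleGraph V) (hRG : R ≤ G)
    (r : Finset V) (hr : ∀ x y : V, R.Adj x y → x ∈ r ∧ y ∈ r)
    (M ℓ k : ℕ) (W : ℕ → Finset V) (hW : IsLinDecompOf R r M ℓ W)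
    (hR3 : ∀ i, 1 ≤ i → i + 1 ≤ M → Disjoint (W (i - 1) ∩ W i) (W i ∩ W (i + 1)))
    (A B : Finset V) (hAB : IsSep G A B) (hk : (A ∩ B).card = k) :
    ((Finset.range (M + 1)).filter fun i => ((A ∩ B) ∩ W i).Nonempty).card ≤ 2 * k ∧
    ((∀ i ≤ M, (R.induce (W i : Set V)).Connected) →
      ((Finset.range (M + 1)).filter
          fun i => ¬ (W i ⊆ A \ B ∨ W i ⊆ B \ A)).card ≤ 2 * k) := by
  have key : ((Finset.range (M + 1)).filter
      fun i => ((A ∩ B) ∩ W i).Nonempty).card ≤ 2 * k := by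
    have hsub : ((Finset.range (M + 1)).filter fun i => ((A ∩ B) ∩ W i).Nonempty) ⊆
        (A ∩ B).biUnion fun x => (Finset.range (M + 1)).filter fun i => x ∈ W i := by
      intro i hi
      obtain ⟨hiM, x, hx⟩ := Finset.mem_filter.1 hi
      obtain ⟨hxAB, hxW⟩ := Finset.mem_inter.1 hx
      exact Finset.mem_biUnion.2 ⟨x, hxAB, Finset.mem_filter.2 ⟨hiM, hxW⟩⟩
    calc _ ≤ _ := Finset.card_le_card hsub
      _ ≤ (A ∩ B).card * 2 :=
        Finset.card_biUnion_le_card_mul _ _ _ fun x _ => hW.card_bags_mem_le_two hR3 x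
      _ = 2 * k := by rw [hk, mul_comm]
  refine ⟨key, fun hR2 => (Finset.card_le_card ?_).trans key⟩
  intro i hi
  obtain ⟨hiM, hside⟩ := Finset.mem_filter.1 hi
  refine Finset.mem_filter.2 ⟨hiM, ?_⟩
  by_contra hne
  exact hside (hAB.subset_or_subset_of_connected hRG
    (hR2 i (Nat.lt_succ_iff.1 (Finset.mem_range.1 hiM))) hne)
end
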